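/- Consider the RGV ensemble of rate R, composition Q_X, distance function d and threshold Δ, and assume the rate condition holds with some parameter δ > 0. Then for any joint type P_{XX'} ∈ 𝒬(Q_X) with I_P(X;X') ≥ 2R and d(P_{XX'}) > Δ: P[N(P_{XX'}) ≥ 1] ≐ exp{n(2R−I_P(X;X'))}. -/

import Mathlib

open Filter Finset
open scoped Classical

noncomputable section

namespace RGV

/-- A probability distribution on a finite type. -/
def IsDist {α : Type} [Fintype α] (p : α → ℝ) : Prop :=
  (∀ a, 0 ≤ p a) ∧ ∑ a, p a = 1

/-- `p` is an `n`-type: all probabilities are integer multiples of `1/n`. -/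
def IsTypeDist {α : Type} (n : ℕ) (p : α → ℝ) : Prop :=
  ∀ a, ∃ k : ℕ, p a * n = k

/-- Empirical distribution of a sequence. -/
def emp {α : Type} [Fintype α] (n : ℕ) (x : Fin n → α) : α → ℝ :=
  fun a => ((Finset.univ.filter fun i => x i = a).card : ℝ) / n

/-- Joint empirical distribution of a pair of sequences. -/
def emp2 {α β : Type} [Fintype α] [Fintype β] (n : ℕ) (x : Fin n → α) (y : Fin n → β) :
    α × β → ℝ :=
  fun ab => ((Finset.univ.filter fun i => x i = ab.1 ∧ y i = ab.2).card : ℝ) / n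

/-- The type class of a composition `Q`. -/
def typeClass {α : Type} [Fintype α] (n : ℕ) (Q : α → ℝ) : Finset (Fin n → α) :=
  Finset.univ.filter fun x => emp n x = Q

/-- The pair type class of a joint type `P`. -/
def typeClass2 {α : Type} [Fintype α] (n : ℕ) (P : α × α → ℝ) :
    Finset ((Fin n → α) × (Fin n → α)) :=
  Finset.univ.filter fun xx => emp2 n xx.1 xx.2 = P

/-- `P` is a joint distribution on `α × α` with both marginals equal to `Q`. -/
def Joint {α : Type} [Fintype α] (Q : α → ℝ) (P : α × α → ℝ) : Prop :=
  IsDist P ∧ (∀ a, ∑ b, P (a, b) = Q a) ∧ (∀ b, ∑ a, P (a, b) = Q b)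

/-- `d` is a distance function: continuous and symmetric. -/
def IsDistance {α : Type} [Fintype α] (d : (α × α → ℝ) → ℝ) : Prop :=
  Continuous d ∧ ∀ P : α × α → ℝ, d (fun p => P (p.2, p.1)) = d P

/-- Mutual information of a joint distribution (natural logarithms). -/
def mutInf {α β : Type} [Fintype α] [Fintype β] (P : α × β → ℝ) : ℝ :=
  ∑ p : α × β, P p * Real.log (P p / ((∑ b, P (p.1, b)) * (∑ a, P (a, p.2))))

/-- Positive part `[t]₊`. -/
def pos (t : ℝ) : ℝ := max t 0

/-- Number of codewords at blocklength `n` and rate `R`. -/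
def Mof (R : ℝ) (n : ℕ) : ℕ := ⌈Real.exp (n * R)⌉₊

/-- The feasible set for the `i`-th codeword given the previous ones. -/
def feasible {α : Type} [Fintype α] (n : ℕ) (Q : α → ℝ) (d : (α × α → ℝ) → ℝ) (Δ : ℝ)
    {M : ℕ} (c : Fin M → Fin n → α) (i : Fin M) : Finset (Fin n → α) :=
  (typeClass n Q).filter fun z => ∀ j, j < i → Δ < d (emp2 n z (c j))

/-- The probability that the RGV construction outputs the codebook `c`. -/
def rgvProb {α : Type} [Fintype α] (n : ℕ) (Q : α → ℝ) (d : (α × α → ℝ) → ℝ) (Δ : ℝ)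
    {M : ℕ} (c : Fin M → Fin n → α) : ℝ :=
  ∏ i : Fin M,
    if c i ∈ feasible n Q d Δ c i then ((feasible n Q d Δ c i).card : ℝ)⁻¹ else 0

/-- Expectation over the RGV ensemble. -/
def expect {α : Type} [Fintype α] (n : ℕ) (Q : α → ℝ) (d : (α × α → ℝ) → ℝ) (Δ : ℝ)
    (M : ℕ) (f : (Fin M → Fin n → α) → ℝ) : ℝ :=
  ∑ c : Fin M → Fin n → α, rgvProb n Q d Δ c * f c

/-- Probability of an event over the RGV ensemble. -/
def prob {α : Type} [Fintype α] (n : ℕ) (Q : α → ℝ) (d : (α × α → ℝ) → ℝ) (Δ : ℝ)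
    (M : ℕ) (S : (Fin M → Fin n → α) → Prop) : ℝ :=
  ∑ c : Fin M → Fin n → α, if S c then rgvProb n Q d Δ c else 0

/-- `W` is a (discrete memoryless) channel. -/
def IsChannel {α β : Type} [Fintype β] (W : α → β → ℝ) : Prop := ∀ a, IsDist (W a)

/-- The product (memoryless) extension of the channel. -/
def Wn {α β : Type} (n : ℕ) (W : α → β → ℝ) (x : Fin n → α) (y : Fin n → β) : ℝ :=
  ∏ i, W (x i) (y i)

/-- GLD error probability of a codebook. -/
def Pe {α β : Type} [Fintype α] [Fintype β] (n : ℕ) (W : α → β → ℝ)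
    (g : (α × β → ℝ) → ℝ) {M : ℕ} (c : Fin M → Fin n → α) : ℝ :=
  (M : ℝ)⁻¹ * ∑ m : Fin M, ∑ m' ∈ Finset.univ.erase m, ∑ y : Fin n → β,
    Wn n W (c m) y * Real.exp ((n : ℝ) * g (emp2 n (c m') y)) /
      ∑ m'' : Fin M, Real.exp ((n : ℝ) * g (emp2 n (c m'') y))

/-- Marginal `P_{XY}` induced by `P_{XX'}` and the conditional law `V = P_{Y|XX'}`. -/
def PXY {α β : Type} [Fintype α] [Fintype β] (P : α × α → ℝ) (V : α × α → β → ℝ) :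
    α × β → ℝ :=
  fun ay => ∑ b, P (ay.1, b) * V (ay.1, b) ay.2

/-- Marginal `P_{X'Y}`. -/
def PXpY {α β : Type} [Fintype α] [Fintype β] (P : α × α → ℝ) (V : α × α → β → ℝ) :
    α × β → ℝ :=
  fun bY => ∑ a, P (a, bY.1) * V (a, bY.1) bY.2

/-- Output marginal `P_Y`. -/
def PYof {α β : Type} [Fintype α] [Fintype β] (P : α × α → ℝ) (V : α × α → β → ℝ) :
    β → ℝ :=
  fun y => ∑ p : α × α, P p * V p y

/-- Conditional divergence `D(P_{Y|X} ‖ W | Q)`. -/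
def condDiv {α β : Type} [Fintype α] [Fintype β] (Q : α → ℝ) (W : α → β → ℝ)
    (P : α × α → ℝ) (V : α × α → β → ℝ) : ℝ :=
  ∑ a, ∑ y, PXY P V (a, y) * Real.log (PXY P V (a, y) / (Q a * W a y))

/-- Conditional mutual information `I(X';Y|X)`. -/
def cmi {α β : Type} [Fintype α] [Fintype β] (P : α × α → ℝ) (V : α × α → β → ℝ) : ℝ :=
  ∑ a, ∑ b, ∑ y, P (a, b) * V (a, b) y *
    Real.log (P (a, b) * V (a, b) y * (∑ b', P (a, b')) /
      (P (a, b) * PXY P V (a, y)))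

/-- The joint distribution on `α × β` induced by `P_Y` and a reverse channel `V'`. -/
def jointOf {α β : Type} (PY : β → ℝ) (V' : β → α → ℝ) : α × β → ℝ :=
  fun ay => PY ay.2 * V' ay.2 ay.1

/-- The quantity `α(R, P_Y)`. -/
def alphaF {α β : Type} [Fintype α] [Fintype β] (Q : α → ℝ) (g : (α × β → ℝ) → ℝ)
    (R : ℝ) (PY : β → ℝ) : ℝ :=
  sSup { v | ∃ V' : β → α → ℝ, (∀ y, IsDist (V' y)) ∧
    (∀ a, ∑ y, PY y * V' y a = Q a) ∧ mutInf (jointOf PY V') ≤ R ∧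
    v = g (jointOf PY V') - mutInf (jointOf PY V') } + R

/-- The exponent `Γ(P_{XX'}, R)`. -/
def Gamma {α β : Type} [Fintype α] [Fintype β] (Q : α → ℝ) (W : α → β → ℝ)
    (g : (α × β → ℝ) → ℝ) (P : α × α → ℝ) (R : ℝ) : ℝ :=
  sInf { v | ∃ V : α × α → β → ℝ, (∀ p, IsDist (V p)) ∧
    v = condDiv Q W P V + cmi P V +
      pos (max (g (PXY P V)) (alphaF Q g R (PYof P V)) - g (PXpY P V)) }

/-- The quantity `β(R, P_Y)`. -/
def betaF {α β : Type} [Fintype α] [Fintype β] (Q : α → ℝ) (g : (α × β → ℝ) → ℝ)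
    (R : ℝ) (PY : β → ℝ) : ℝ :=
  sSup { v | ∃ V' : β → α → ℝ, (∀ y, IsDist (V' y)) ∧
    (∀ a, ∑ y, PY y * V' y a = Q a) ∧
    v = g (jointOf PY V') + pos (R - mutInf (jointOf PY V')) }

/-- The exponent `Λ(P_{XX'}, R)`. -/
def Lambda {α β : Type} [Fintype α] [Fintype β] (Q : α → ℝ) (W : α → β → ℝ)
    (g : (α × β → ℝ) → ℝ) (P : α × α → ℝ) (R : ℝ) : ℝ :=
  sInf { v | ∃ V : α × α → β → ℝ, (∀ p, IsDist (V p)) ∧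
    v = condDiv Q W P V + cmi P V + betaF Q g R (PYof P V) - g (PXpY P V) }

/-- The candidate value of the typical random coding exponent of the RGV ensemble. -/
def EtrcVal {α β : Type} [Fintype α] [Fintype β] (Q : α → ℝ) (W : α → β → ℝ)
    (g : (α × β → ℝ) → ℝ) (d : (α × α → ℝ) → ℝ) (Δ R : ℝ) : ℝ :=
  sInf { v | ∃ P : α × α → ℝ, Joint Q P ∧ mutInf P ≤ 2 * R ∧ Δ < d P ∧
    v = Gamma Q W g P R + mutInf P - R }

/-- The expurgated exponent. -/
def Eex {α β : Type} [Fintype α] [Fintype β] (Q : α → ℝ) (W : α → β → ℝ)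
    (g : (α × β → ℝ) → ℝ) (R : ℝ) : ℝ :=
  sInf { v | ∃ P : α × α → ℝ, Joint Q P ∧ mutInf P ≤ R ∧
    v = Gamma Q W g P R + mutInf P - R }

/-- The expurgated exponent of the RGV ensemble. -/
def EexRgv {α β : Type} [Fintype α] [Fintype β] (Q : α → ℝ) (W : α → β → ℝ)
    (g : (α × β → ℝ) → ℝ) (d : (α × α → ℝ) → ℝ) (Δ R : ℝ) : ℝ :=
  sInf { v | ∃ P : α × α → ℝ, Joint Q P ∧ Δ < d P ∧ mutInf P ≤ R ∧
    v = Gamma Q W g P R + mutInf P - R }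

/-- The rate condition at blocklength `n` with parameter `δ`
(the minimum over an empty collection of joint types being `+∞`). -/
def RateCond {α : Type} [Fintype α] (n : ℕ) (Q : α → ℝ) (d : (α × α → ℝ) → ℝ)
    (Δ R δ : ℝ) : Prop :=
  ((R : ℝ) : EReal) ≤
    sInf { v : EReal | ∃ P : α × α → ℝ, Joint Q P ∧ IsTypeDist n P ∧ d P ≤ Δ ∧
      v = ((mutInf P : ℝ) : EReal) } - (((2 * δ : ℝ)) : EReal)

/-- Type enumerator: the number of ordered pairs of distinct codewords
with joint empirical distribution `P`. -/
def Nenum {α : Type} [Fintype α] (n : ℕ) (P : α × α → ℝ) {M : ℕ}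
    (c : Fin M → Fin n → α) : ℕ :=
  ((Finset.univ : Finset (Fin M × Fin M)).filter fun mm =>
    mm.1 ≠ mm.2 ∧ emp2 n (c mm.1) (c mm.2) = P).card

/-- Normalized log of a probability (exponential rate), valued in `EReal`. -/
def lrate (n : ℕ) (p : ℝ) : EReal :=
  if p ≤ 0 then ⊥ else ((Real.log p / n : ℝ) : EReal)

/-- Normalized iterated-log rate (double-exponential decay rate), valued in `EReal`. -/
def drate (n : ℕ) (p : ℝ) : EReal :=
  if p ≤ 0 then ⊤ else if 1 ≤ p then ⊥
  else ((Real.log (-Real.log p) / n : ℝ) : EReal)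

/-- `δ_n = e^{-nδ}/(1-e^{-nδ})`. -/
def deltan (n : ℕ) (δ : ℝ) : ℝ := Real.exp (-(n * δ)) / (1 - Real.exp (-(n * δ)))


/-- Blocklength sequence: the multiples of the denominator `D` of the composition. -/
def nseq (D t : ℕ) : ℕ := D * (t + 1)

/-- The normalized expected log error probability `-(1/n) E[log P_e(C_n)]`. -/
def Expnt {α β : Type} [Fintype α] [Fintype β] (n : ℕ) (Q : α → ℝ)
    (d : (α × α → ℝ) → ℝ) (Δ : ℝ) (W : α → β → ℝ) (g : (α × β → ℝ) → ℝ) (R : ℝ) : ℝ :=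
  -(expect n Q d Δ (Mof R n) (fun c => Real.log (Pe n W g c)) / n)

/-- Ratio of type class sizes `|T(P)| / |T(Q)|²`. -/
def Lsize {α : Type} [Fintype α] (n : ℕ) (Q : α → ℝ) (P : α × α → ℝ) : ℝ :=
  ((typeClass2 n P).card : ℝ) / ((typeClass n Q).card : ℝ) ^ 2

end RGV

namespace RGV

/-- The points of `T` compatible with every entry of `c`. -/
def seqFeas {X : Type} (T : Finset X) (G : X → X → Prop) {M : ℕ} (c : Fin M → X) : Finset X :=
  T.filter fun z => ∀ j, G z (c j)

/-- The conditional probability that the next point is `x` given the previous points `c`. -/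
def seqStep {X : Type} (T : Finset X) (G : X → X → Prop) {M : ℕ} (c : Fin M → X) (x : X) : ℝ :=
  if x ∈ seqFeas T G c then ((seqFeas T G c).card : ℝ)⁻¹ else 0

/-- The probability of `c` when points of `T` are drawn sequentially, each one uniformly among
those compatible with its predecessors. -/
def seqProb {X : Type} (T : Finset X) (G : X → X → Prop) {M : ℕ} (c : Fin M → X) : ℝ :=
  ∏ i : Fin M,
    if c i ∈ T.filter (fun z => ∀ j, j < i → G z (c j)) then
      ((T.filter (fun z => ∀ j, j < i → G z (c j))).card : ℝ)⁻¹ else 0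

/-- Expectation under `seqProb`. -/
def seqE {X : Type} [Fintype X] (T : Finset X) (G : X → X → Prop) (M : ℕ)
    (f : (Fin M → X) → ℝ) : ℝ :=
  ∑ c : Fin M → X, seqProb T G c * f c

section Sequential

variable {X : Type} {T : Finset X} {G : X → X → Prop}

lemma seqProb_nonneg {M : ℕ} (c : Fin M → X) : 0 ≤ seqProb T G c :=
  Finset.prod_nonneg fun i _ => by split_ifs <;> positivity

lemma seqProb_snoc {M : ℕ} (c : Fin M → X) (x : X) :
    seqProb T G (Fin.snoc c x : Fin (M + 1) → X) = seqProb T G c * seqStep T G c x := by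
  unfold seqProb
  rw [Fin.prod_univ_castSucc]
  congr 1
  · refine Finset.prod_congr rfl fun i _ => ?_
    have h : T.filter (fun z => ∀ j, j < i.castSucc → G z ((Fin.snoc c x : Fin (M + 1) → X) j)) =
        T.filter (fun z => ∀ j, j < i → G z (c j)) := by
      refine Finset.filter_congr fun z _ => ?_
      rw [Fin.forall_fin_succ']
      simp [Fin.not_lt.mpr (Fin.le_last _)]
    rw [h]
    simp
  · have h : T.filter (fun z => ∀ j, j < Fin.last M → G z ((Fin.snoc c x : Fin (M + 1) → X) j)) =
        seqFeas T G c := by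
      refine Finset.filter_congr fun z _ => ?_
      rw [Fin.forall_fin_succ']
      simp [Fin.castSucc_lt_last]
    rw [h]
    simp [seqStep]

lemma mem_of_seqProb_ne_zero {M : ℕ} {c : Fin M → X} (h : seqProb T G c ≠ 0) (i : Fin M) :
    c i ∈ T := by
  by_contra hi
  exact h (Finset.prod_eq_zero (Finset.mem_univ i) (by simp [hi]))

lemma seqFeas_card_ge {b : ℝ} (hb : ∀ y ∈ T, ((T.filter fun z => ¬ G z y).card : ℝ) ≤ b)
    {M : ℕ} {c : Fin M → X} (hc : ∀ i, c i ∈ T) :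
    (T.card : ℝ) - M * b ≤ (seqFeas T G c).card := by
  have h1 : T ⊆ seqFeas T G c ∪ Finset.univ.biUnion fun j => T.filter fun z => ¬ G z (c j) := by
    intro z hz
    by_cases h : ∀ j, G z (c j)
    · simp [seqFeas, hz, h]
    · push Not at h
      obtain ⟨j, hj⟩ := h
      simp only [Finset.mem_union, Finset.mem_biUnion, Finset.mem_filter]
      exact Or.inr ⟨j, Finset.mem_univ j, hz, hj⟩
  have h2 : (T.card : ℝ) ≤ (seqFeas T G c).card +
      ∑ j : Fin M, ((T.filter fun z => ¬ G z (c j)).card : ℝ) := by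
    exact_mod_cast (Finset.card_le_card h1).trans ((Finset.card_union_le _ _).trans
      (Nat.add_le_add_left Finset.card_biUnion_le _))
  have h3 : ∑ j : Fin M, ((T.filter fun z => ¬ G z (c j)).card : ℝ) ≤ ∑ _j : Fin M, b :=
    Finset.sum_le_sum fun j _ => hb _ (hc j)
  simp at h3
  linarith

variable [Fintype X]

lemma seqE_succ (M : ℕ) (f : (Fin (M + 1) → X) → ℝ) :
    seqE T G (M + 1) f =
      seqE T G M fun c => ∑ x, seqStep T G c x * f (Fin.snoc c x) := by
  unfold seqE
  rw [← Equiv.sum_comp (Fin.snocEquiv fun _ => X), Fintype.sum_prod_type, Finset.sum_comm]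
  refine Finset.sum_congr rfl fun c _ => ?_
  rw [Finset.mul_sum]
  refine Finset.sum_congr rfl fun x _ => ?_
  have : (Fin.snocEquiv fun _ : Fin (M + 1) => X) (x, c) = Fin.snoc c x := rfl
  rw [this, seqProb_snoc, mul_assoc]

lemma seqE_mono {M : ℕ} {f g : (Fin M → X) → ℝ} (h : ∀ c, (∀ i, c i ∈ T) → f c ≤ g c) :
    seqE T G M f ≤ seqE T G M g := by
  refine Finset.sum_le_sum fun c _ => ?_
  by_cases hc : seqProb T G c = 0
  · simp [hc]
  · exact mul_le_mul_of_nonneg_left (h c (mem_of_seqProb_ne_zero hc)) (seqProb_nonneg c)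

lemma seqE_congr {M : ℕ} {f g : (Fin M → X) → ℝ} (h : ∀ c, (∀ i, c i ∈ T) → f c = g c) :
    seqE T G M f = seqE T G M g :=
  le_antisymm (seqE_mono fun c hc => (h c hc).le) (seqE_mono fun c hc => (h c hc).ge)

lemma seqE_nonneg {M : ℕ} {f : (Fin M → X) → ℝ} (h : ∀ c, 0 ≤ f c) : 0 ≤ seqE T G M f :=
  Finset.sum_nonneg fun c _ => mul_nonneg (seqProb_nonneg c) (h c)

lemma seqE_sum {M : ℕ} {ι : Type} (s : Finset ι) (f : ι → (Fin M → X) → ℝ) :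
    seqE T G M (fun c => ∑ k ∈ s, f k c) = ∑ k ∈ s, seqE T G M (f k) := by
  unfold seqE
  simp_rw [Finset.mul_sum]
  exact Finset.sum_comm

lemma seqE_mul_const {M : ℕ} (f : (Fin M → X) → ℝ) (r : ℝ) :
    seqE T G M (fun c => f c * r) = seqE T G M f * r := by
  unfold seqE
  rw [Finset.sum_mul]
  simp_rw [mul_assoc]

lemma seqE_sub {M : ℕ} (f g : (Fin M → X) → ℝ) :
    seqE T G M (fun c => f c - g c) = seqE T G M f - seqE T G M g := by
  unfold seqE
  simp_rw [mul_sub, Finset.sum_sub_distrib]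

/-- The Cauchy–Schwarz lower bound on the probability that a count is nonzero. -/
lemma seqE_sq_le {M : ℕ} (f : (Fin M → X) → ℝ) :
    seqE T G M f ^ 2 ≤
      seqE T G M (fun c => if f c ≠ 0 then 1 else 0) * seqE T G M (fun c => f c ^ 2) := by
  unfold seqE
  refine Finset.sum_sq_le_sum_mul_sum_of_sq_le_mul _ (fun c _ => ?_) (fun c _ => ?_)
    (fun c _ => ?_)
  · exact mul_nonneg (seqProb_nonneg c) (by dsimp only; split_ifs <;> norm_num)
  · exact mul_nonneg (seqProb_nonneg c) (sq_nonneg _)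
  · by_cases h : f c = 0
    · simp [h]
    · simp only [ne_eq, h, not_false_eq_true, if_true]
      exact le_of_eq (by ring)

lemma seqStep_sum_mem_le {M : ℕ} (c : Fin M → X) (Y : Finset X) {r : ℝ} (hr : 0 < r)
    (h : r ≤ (seqFeas T G c).card) :
    ∑ x, seqStep T G c x * (if x ∈ Y then 1 else 0) ≤ Y.card / r := by
  have : ∑ x, seqStep T G c x * (if x ∈ Y then 1 else 0) = ∑ x ∈ Y, seqStep T G c x := by
    simp [Finset.sum_ite_mem]
  rw [this, div_eq_mul_inv, ← nsmul_eq_mul]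
  refine Finset.sum_le_card_nsmul _ _ _ fun x _ => ?_
  unfold seqStep
  split_ifs
  · exact inv_anti₀ hr h
  · positivity

lemma seqStep_sum {M : ℕ} (c : Fin M → X) (h : 0 < ((seqFeas T G c).card : ℝ)) :
    ∑ x, seqStep T G c x = 1 := by
  unfold seqStep
  rw [← Finset.sum_filter, Finset.sum_const, nsmul_eq_mul]
  simp only [Finset.filter_univ_mem]
  exact mul_inv_cancel₀ h.ne'

lemma seqE_prod_le {b : ℝ} (hT : 0 < T.card)
    (hb : ∀ y ∈ T, ((T.filter fun z => ¬ G z y).card : ℝ) ≤ b) (hb0 : 0 ≤ b) {M : ℕ}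
    (hM : 2 * (M * b) ≤ T.card) (S : Finset (Fin M)) (Y : Fin M → Finset X) :
    seqE T G M (fun c => ∏ i, if i ∈ S then (if c i ∈ Y i then (1 : ℝ) else 0) else 1) ≤
      ∏ i, if i ∈ S then 2 * ((Y i).card : ℝ) / T.card else 1 := by
  induction M with
  | zero => simp [seqE, seqProb]
  | succ M ih =>
    have hT' : (0 : ℝ) < T.card := by exact_mod_cast hT
    push_cast at hM
    have hM' : 2 * (M * b) ≤ T.card := by nlinarith
    have ih' := ih hM' (Finset.univ.filter fun i => i.castSucc ∈ S) (fun i => Y i.castSucc)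
    simp only [Finset.mem_filter, Finset.mem_univ, true_and] at ih'
    rw [seqE_succ, Fin.prod_univ_castSucc]
    have hβ : (0 : ℝ) ≤ if Fin.last M ∈ S then 2 * ((Y (Fin.last M)).card : ℝ) / T.card else 1 := by
      split_ifs <;> positivity
    refine le_trans ?_ (mul_le_mul_of_nonneg_right ih' hβ)
    rw [← seqE_mul_const]
    refine seqE_mono fun c hc => ?_
    have hF := seqFeas_card_ge (G := G) hb hc
    have hF' : (T.card : ℝ) / 2 ≤ (seqFeas T G c).card := by linarith
    simp only [Fin.prod_univ_castSucc, Fin.snoc_castSucc, Fin.snoc_last]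
    simp_rw [mul_left_comm (seqStep T G c _)]
    rw [← Finset.mul_sum]
    refine mul_le_mul_of_nonneg_left ?_ (Finset.prod_nonneg fun i _ => ?_)
    · split_ifs with hl
      · refine (seqStep_sum_mem_le c _ (half_pos hT') hF').trans (le_of_eq ?_)
        field_simp
      · simp only [mul_one]
        exact (seqStep_sum c (by linarith [half_pos hT'])).le
    · split_ifs <;> norm_num

/-- The probability that the points with index in `S` lie in prescribed sets is at most
`2 ^ #S` times what it is for independent uniform points. -/
lemma seqE_mem_le {b : ℝ} (hT : 0 < T.card)
    (hb : ∀ y ∈ T, ((T.filter fun z => ¬ G z y).card : ℝ) ≤ b) (hb0 : 0 ≤ b) {M : ℕ}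
    (hM : 2 * (M * b) ≤ T.card) (S : Finset (Fin M)) (Y : Fin M → Finset X) :
    seqE T G M (fun c => if ∀ i ∈ S, c i ∈ Y i then 1 else 0) ≤
      ∏ i ∈ S, 2 * ((Y i).card : ℝ) / T.card := by
  have h := seqE_prod_le hT hb hb0 hM S Y
  simp only [Finset.prod_ite_mem, Finset.univ_inter] at h
  refine le_trans (le_of_eq (seqE_congr fun c _ => ?_)) h
  rw [Finset.prod_ite_zero]
  simp

lemma seqE_succ_of_init {b : ℝ} (hT : 0 < T.card)
    (hb : ∀ y ∈ T, ((T.filter fun z => ¬ G z y).card : ℝ) ≤ b) {M : ℕ}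
    (hM : 2 * (M * b) ≤ T.card) {f : (Fin (M + 1) → X) → ℝ} {g : (Fin M → X) → ℝ}
    (hfg : ∀ c x, f (Fin.snoc c x) = g c) : seqE T G (M + 1) f = seqE T G M g := by
  rw [seqE_succ]
  refine seqE_congr fun c hc => ?_
  have hF := seqFeas_card_ge (G := G) hb hc
  have hT' : (0 : ℝ) < T.card := by exact_mod_cast hT
  simp_rw [hfg, ← Finset.sum_mul]
  rw [seqStep_sum c (by linarith), one_mul]

/-- The total mass is one. -/
lemma seqE_one {b : ℝ} (hT : 0 < T.card)
    (hb : ∀ y ∈ T, ((T.filter fun z => ¬ G z y).card : ℝ) ≤ b) (hb0 : 0 ≤ b) {M : ℕ}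
    (hM : 2 * (M * b) ≤ T.card) : seqE T G M (fun _ => 1) = 1 := by
  induction M with
  | zero => simp [seqE, seqProb]
  | succ M ih =>
    push_cast at hM
    have hM' : 2 * (M * b) ≤ T.card := by nlinarith
    rw [seqE_succ_of_init hT hb hM' (g := fun _ => 1) fun _ _ => rfl, ih hM']

/-- A point that is rarely excluded by its predecessors is drawn at index `i` with nearly
uniform probability, whatever is known about the earlier points. -/
lemma le_seqE_eq {b : ℝ} (hT : 0 < T.card)
    (hb : ∀ y ∈ T, ((T.filter fun z => ¬ G z y).card : ℝ) ≤ b) (hb0 : 0 ≤ b) {M : ℕ}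
    (hM : 2 * (M * b) ≤ T.card) (i : Fin M) {y : X} (hy : y ∈ T) {f : (Fin M → X) → ℝ}
    (hf : ∀ c, 0 ≤ f c) (hfi : ∀ c c', (∀ j, j < i → c j = c' j) → f c = f c') :
    (seqE T G M f - ∑ j : Fin M, if j < i then
        seqE T G M (fun c => f c * if ¬ G y (c j) then 1 else 0) else 0) * (T.card : ℝ)⁻¹ ≤
      seqE T G M (fun c => f c * if c i = y then 1 else 0) := by
  induction M with
  | zero => exact i.elim0
  | succ M ih =>
    have hT' : (0 : ℝ) < T.card := by exact_mod_cast hT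
    push_cast at hM
    have hM' : 2 * (M * b) ≤ T.card := by nlinarith
    have hlast : ∀ c x, f (Fin.snoc c x) = f (Fin.snoc c y) := fun c x => by
      refine hfi _ _ fun j hj => ?_
      obtain ⟨j, rfl⟩ := Fin.exists_castSucc_eq.mpr (ne_of_lt (hj.trans_le (Fin.le_last i)))
      simp
    have e1 := seqE_succ_of_init (G := G) hT hb hM' hlast
    have e2 : ∀ j : Fin M, seqE T G (M + 1)
        (fun c => f c * if ¬ G y (c j.castSucc) then 1 else 0) =
        seqE T G M (fun c => f (Fin.snoc c y) * if ¬ G y (c j) then 1 else 0) := fun j =>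
      seqE_succ_of_init hT hb hM' fun c x => by simp [hlast c x]
    rw [Fin.sum_univ_castSucc, e1, if_neg (Fin.not_lt.mpr (Fin.le_last i)), add_zero]
    simp_rw [e2]
    induction i using Fin.lastCases with
    | last =>
      simp only [Fin.castSucc_lt_last, if_true]
      rw [seqE_succ, ← seqE_sum, ← seqE_sub, ← seqE_mul_const]
      refine seqE_mono fun c hc => ?_
      simp only [Fin.snoc_last, mul_ite, mul_one, mul_zero, Finset.sum_ite_eq', Finset.mem_univ,
        if_true]
      unfold seqStep
      split_ifs with hyF
      · have hle : ((seqFeas T G c).card : ℝ) ≤ T.card := by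
          exact_mod_cast Finset.card_le_card (Finset.filter_subset _ _)
        have hpos : (0 : ℝ) < (seqFeas T G c).card := by
          exact_mod_cast Finset.card_pos.mpr ⟨y, hyF⟩
        rw [mul_comm]
        refine mul_le_mul (inv_anti₀ hpos hle) ?_ ?_ (by positivity)
        · have : 0 ≤ ∑ j : Fin M, if ¬ G y (c j) then f (Fin.snoc c y) else 0 :=
            Finset.sum_nonneg fun j _ => by split_ifs <;> simp [hf]
          linarith
        · have hG : ∀ j, G y (c j) := by simpa [seqFeas, hy] using hyF
          simp [hG, hf]
      · have hG : ∃ j, ¬ G y (c j) := by simpa [seqFeas, hy] using hyF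
        obtain ⟨j, hj⟩ := hG
        have : f (Fin.snoc c y) ≤ ∑ j : Fin M, if ¬ G y (c j) then f (Fin.snoc c y) else 0 := by
          refine le_trans (by simp [hj]) (Finset.single_le_sum
            (f := fun j : Fin M => if ¬ G y (c j) then f (Fin.snoc c y) else 0)
            (fun j _ => ?_) (Finset.mem_univ j))
          split_ifs <;> simp [hf]
        have h0 : f (Fin.snoc c y) - ∑ j : Fin M, (if ¬ G y (c j) then f (Fin.snoc c y) else 0)
          ≤ 0 := by linarith
        simpa using mul_nonpos_of_nonpos_of_nonneg h0 (inv_nonneg.mpr hT'.le)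
    | cast i =>
      have e3 : seqE T G (M + 1) (fun c => f c * if c i.castSucc = y then 1 else 0) =
          seqE T G M (fun c => f (Fin.snoc c y) * if c i = y then 1 else 0) :=
        seqE_succ_of_init hT hb hM' fun c x => by simp [hlast c x]
      rw [e3]
      simp only [Fin.castSucc_lt_castSucc_iff]
      refine ih hM' i (fun c => hf _) fun c c' h => hfi _ _ fun j hj => ?_
      obtain ⟨j, rfl⟩ := Fin.exists_castSucc_eq.mpr
        (ne_of_lt (hj.trans_le (Fin.le_last _)))
      simpa using h j (by simpa using hj)

end Sequential

/-- The number of ordered pairs of distinct indices whose points are related. -/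
def pairCount {X : Type} (A : X → X → Prop) {M : ℕ} (c : Fin M → X) : ℕ :=
  ((Finset.univ : Finset (Fin M × Fin M)).filter fun mm =>
    mm.1 ≠ mm.2 ∧ A (c mm.1) (c mm.2)).card

lemma pairCount_eq_sum {X : Type} (A : X → X → Prop) {M : ℕ} (c : Fin M → X) :
    (pairCount A c : ℝ) =
      ∑ p ∈ (Finset.univ : Finset (Fin M)).offDiag, if A (c p.1) (c p.2) then 1 else 0 := by
  rw [Finset.sum_boole, pairCount]
  congr 2
  ext p
  simp

section PairCount

variable {X : Type} [Fintype X] {T : Finset X} {G : X → X → Prop}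

lemma seqE_fix_mem_le {b : ℝ} (hT : 0 < T.card)
    (hb : ∀ y ∈ T, ((T.filter fun z => ¬ G z y).card : ℝ) ≤ b) (hb0 : 0 ≤ b) {M : ℕ}
    (hM : 2 * (M * b) ≤ T.card) (S : Finset (Fin M)) (w : Fin M → X) {k : Fin M} (hk : k ∉ S)
    (Y : Finset X) :
    seqE T G M (fun c => if (∀ i ∈ S, c i = w i) ∧ c k ∈ Y then 1 else 0) ≤
      (2 / T.card : ℝ) ^ S.card * (2 * (Y.card : ℝ) / T.card) := by
  have h := seqE_mem_le (G := G) hT hb hb0 hM (insert k S) (fun i => if i = k then Y else {w i})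
  have hne : ∀ i ∈ S, i ≠ k := fun i hi h => hk (h ▸ hi)
  rw [Finset.prod_insert hk] at h
  have h1 : ∏ i ∈ S, 2 * (((if i = k then Y else {w i}) : Finset X).card : ℝ) / T.card =
      (2 / T.card : ℝ) ^ S.card := by
    rw [← Finset.prod_const]
    exact Finset.prod_congr rfl fun i hi => by simp [hne i hi]
  rw [h1, if_pos rfl, mul_comm] at h
  refine le_trans (le_of_eq (seqE_congr fun c _ => ?_)) h
  congr 1
  rw [Finset.forall_mem_insert, if_pos rfl, and_comm, eq_iff_iff]
  exact and_congr_right fun _ => forall₂_congr fun i hi => by simp [hne i hi]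

lemma seqE_fix_rel_le {b : ℝ} (hT : 0 < T.card)
    (hb : ∀ y ∈ T, ((T.filter fun z => ¬ G z y).card : ℝ) ≤ b) (hb0 : 0 ≤ b) {M : ℕ}
    (hM : 2 * (M * b) ≤ T.card) {A : X → X → Prop} {D : ℝ}
    (hA : ∀ x ∈ T, ((T.filter fun y => A x y).card : ℝ) ≤ D)
    (S : Finset (Fin M)) (w : Fin M → X) {k k' : Fin M} (hk : k ∉ S) (hk' : k' ∉ S)
    (hkk : k ≠ k') :
    seqE T G M (fun c => if (∀ i ∈ S, c i = w i) ∧ A (c k) (c k') then 1 else 0) ≤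
      (2 / T.card : ℝ) ^ S.card * (4 * D / T.card) := by
  have hT' : (0 : ℝ) < T.card := by exact_mod_cast hT
  have h1 : seqE T G M (fun c => if (∀ i ∈ S, c i = w i) ∧ A (c k) (c k') then 1 else 0) ≤
      seqE T G M (fun c => ∑ u ∈ T, if (∀ i ∈ insert k S, c i = Function.update w k u i) ∧
        c k' ∈ T.filter (fun y => A u y) then 1 else 0) := by
    refine seqE_mono fun c hc => ?_
    split_ifs with h
    · refine le_trans (le_of_eq ?_) (Finset.single_le_sum
        (f := fun u => if (∀ i ∈ insert k S, c i = Function.update w k u i) ∧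
        c k' ∈ T.filter (fun y => A u y) then (1 : ℝ) else 0)
        (fun u _ => by split_ifs <;> norm_num) (hc k))
      refine (if_pos ⟨fun i hi => ?_, Finset.mem_filter.mpr ⟨hc k', h.2⟩⟩).symm
      by_cases hik : i = k
      · subst hik; simp
      · rw [Function.update_of_ne hik]
        exact h.1 i (Finset.mem_of_mem_insert_of_ne hi hik)
    · exact Finset.sum_nonneg fun u _ => by split_ifs <;> norm_num
  rw [seqE_sum] at h1
  have h2 : ∀ u ∈ T, seqE T G M (fun c =>
      if (∀ i ∈ insert k S, c i = Function.update w k u i) ∧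
        c k' ∈ T.filter (fun y => A u y) then 1 else 0) ≤
      (2 / T.card : ℝ) ^ (S.card + 1) * (2 * D / T.card) := fun u hu => by
    refine (seqE_fix_mem_le hT hb hb0 hM (insert k S) _ (by simp [hk', hkk.symm]) _).trans ?_
    rw [Finset.card_insert_of_notMem hk]
    gcongr
    exact hA u hu
  refine (h1.trans (Finset.sum_le_card_nsmul _ _ _ h2)).trans (le_of_eq ?_)
  rw [nsmul_eq_mul, pow_succ]
  field_simp
  ring

/-- The probability that two given points are related. -/
lemma seqE_rel_le {b : ℝ} (hT : 0 < T.card)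
    (hb : ∀ y ∈ T, ((T.filter fun z => ¬ G z y).card : ℝ) ≤ b) (hb0 : 0 ≤ b) {M : ℕ}
    (hM : 2 * (M * b) ≤ T.card) {A : X → X → Prop} {D : ℝ}
    (hA : ∀ x ∈ T, ((T.filter fun y => A x y).card : ℝ) ≤ D) {k k' : Fin M} (hkk : k ≠ k') :
    seqE T G M (fun c => if A (c k) (c k') then 1 else 0) ≤ 4 * D / T.card := by
  obtain ⟨x, _⟩ := Finset.card_pos.mp hT
  simpa using seqE_fix_rel_le (G := G) hT hb hb0 hM hA ∅ (fun _ => x) (k := k) (k' := k')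
    (by simp) (by simp) hkk

lemma seqE_rel_rel_le {b : ℝ} (hT : 0 < T.card)
    (hb : ∀ y ∈ T, ((T.filter fun z => ¬ G z y).card : ℝ) ≤ b) (hb0 : 0 ≤ b) {M : ℕ}
    (hM : 2 * (M * b) ≤ T.card) {A : X → X → Prop} {D : ℝ}
    (hA : ∀ x ∈ T, ((T.filter fun y => A x y).card : ℝ) ≤ D)
    (hA' : ∀ y ∈ T, ((T.filter fun x => A x y).card : ℝ) ≤ D) {m m' k k' : Fin M}
    (hmm : m ≠ m') (hkk : k ≠ k') (h1 : ¬ (k = m ∧ k' = m')) (h2 : ¬ (k = m' ∧ k' = m)) :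
    seqE T G M (fun c => if A (c m) (c m') ∧ A (c k) (c k') then 1 else 0) ≤
      16 * (D / T.card) ^ 2 := by
  have hT' : (0 : ℝ) < T.card := by exact_mod_cast hT
  have hD : 0 ≤ D := by
    obtain ⟨x, hx⟩ := Finset.card_pos.mp hT
    exact (Nat.cast_nonneg _).trans (hA x hx)
  have hcard : ({m, m'} : Finset (Fin M)).card = 2 := Finset.card_pair hmm
  have key : ∀ w : Fin M → X, (∀ i, w i ∈ T) → seqE T G M (fun c =>
      if (∀ i ∈ ({m, m'} : Finset (Fin M)), c i = w i) ∧ A (c k) (c k') then 1 else 0) ≤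
      (2 / T.card : ℝ) ^ 2 * (4 * D / T.card) := fun w hw => by
    have hone : ∀ (l : Fin M) (Y : Finset X), l ∉ ({m, m'} : Finset (Fin M)) →
        (Y.card : ℝ) ≤ D →
        (∀ c : Fin M → X, (∀ i, c i ∈ T) → (∀ i ∈ ({m, m'} : Finset (Fin M)), c i = w i) →
          A (c k) (c k') → c l ∈ Y) →
        seqE T G M (fun c => if (∀ i ∈ ({m, m'} : Finset (Fin M)), c i = w i) ∧
          A (c k) (c k') then 1 else 0) ≤ (2 / T.card : ℝ) ^ 2 * (4 * D / T.card) := by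
      intro l Y hl hY himp
      have h := seqE_fix_mem_le (G := G) hT hb hb0 hM {m, m'} w hl Y
      rw [hcard] at h
      refine le_trans (seqE_mono fun c hc => ?_) (h.trans ?_)
      · split_ifs with ha hb'
        · exact le_rfl
        · exact absurd ⟨ha.1, himp c hc ha.1 ha.2⟩ hb'
        · norm_num
        · exact le_rfl
      · gcongr ?_ * (?_ / _)
        linarith
    by_cases hk : k ∈ ({m, m'} : Finset (Fin M))
    · have hk' : k' ∉ ({m, m'} : Finset (Fin M)) := by
        simp only [Finset.mem_insert, Finset.mem_singleton] at hk ⊢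
        grind
      refine hone k' (T.filter fun y => A (w k) y) hk' (hA _ (hw k)) fun c hc hS hr => ?_
      rw [← hS k hk]
      exact Finset.mem_filter.mpr ⟨hc k', hr⟩
    · by_cases hk' : k' ∈ ({m, m'} : Finset (Fin M))
      · refine hone k (T.filter fun x => A x (w k')) hk (hA' _ (hw k')) fun c hc hS hr => ?_
        rw [← hS k' hk']
        exact Finset.mem_filter.mpr ⟨hc k, hr⟩
      · have h := seqE_fix_rel_le (G := G) hT hb hb0 hM hA {m, m'} w hk hk' hkk
        rwa [hcard] at h
  have h3 : seqE T G M (fun c => if A (c m) (c m') ∧ A (c k) (c k') then 1 else 0) ≤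
      seqE T G M (fun c => ∑ x ∈ T, ∑ y ∈ T.filter (fun y => A x y),
        if (∀ i ∈ ({m, m'} : Finset (Fin M)), c i = if i = m then x else y) ∧
          A (c k) (c k') then 1 else 0) := by
    refine seqE_mono fun c hc => ?_
    split_ifs with h
    · refine le_trans (le_trans (le_of_eq ?_) (Finset.single_le_sum
        (f := fun y => if (∀ i ∈ ({m, m'} : Finset (Fin M)), c i = if i = m then c m else y) ∧
          A (c k) (c k') then (1 : ℝ) else 0)
        (fun u _ => by split_ifs <;> norm_num)
        (Finset.mem_filter.mpr ⟨hc m', h.1⟩))) (Finset.single_le_sum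
        (f := fun x => ∑ y ∈ T.filter (fun y => A x y),
          if (∀ i ∈ ({m, m'} : Finset (Fin M)), c i = if i = m then x else y) ∧
          A (c k) (c k') then (1 : ℝ) else 0)
        (fun u _ => Finset.sum_nonneg fun y _ => by split_ifs <;> norm_num) (hc m))
      refine (if_pos ⟨?_, h.2⟩).symm
      simp [hmm.symm]
    · exact Finset.sum_nonneg fun x _ => Finset.sum_nonneg fun y _ => by split_ifs <;> norm_num
  refine h3.trans ?_
  simp_rw [seqE_sum]
  have h4 : ∀ x ∈ T, ∑ y ∈ T.filter (fun y => A x y), seqE T G M (fun c =>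
      if (∀ i ∈ ({m, m'} : Finset (Fin M)), c i = if i = m then x else y) ∧
          A (c k) (c k') then 1 else 0) ≤ D * ((2 / T.card : ℝ) ^ 2 * (4 * D / T.card)) := by
    intro x hx
    refine (Finset.sum_le_card_nsmul _ _ _ fun y hy => key _ fun i => ?_).trans ?_
    · split_ifs
      · exact hx
      · exact (Finset.mem_filter.mp hy).1
    · rw [nsmul_eq_mul]
      exact mul_le_mul_of_nonneg_right (hA x hx) (by positivity)
  refine (Finset.sum_le_card_nsmul _ _ _ h4).trans (le_of_eq ?_)
  rw [nsmul_eq_mul]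
  field_simp
  ring

/-- A compatible pair of points of `T` is drawn at two given indices with at least half of the
uniform probability. -/
lemma le_seqE_eq_eq {b : ℝ} (hT : 0 < T.card) (hG : ∀ x y, G x y → G y x)
    (hb : ∀ y ∈ T, ((T.filter fun z => ¬ G z y).card : ℝ) ≤ b) (hb0 : 0 ≤ b) {M : ℕ}
    (hM : 12 * (M * b) ≤ T.card) {x y : X} (hx : x ∈ T) (hy : y ∈ T) (hxy : G x y)
    {m m' : Fin M} (hmm : m ≠ m') :
    (2 * (T.card : ℝ) ^ 2)⁻¹ ≤
      seqE T G M (fun c => if c m = x ∧ c m' = y then 1 else 0) := by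
  wlog hlt : m < m' generalizing m m' x y
  · simp_rw [and_comm (a := _ = x)]
    exact this hy hx (hG _ _ hxy) hmm.symm (lt_of_le_of_ne (not_lt.mp hlt) hmm.symm)
  have hT' : (0 : ℝ) < T.card := by exact_mod_cast hT
  have hMb : 0 ≤ (M : ℝ) * b := by positivity
  have hM2 : 2 * (M * b) ≤ T.card := by linarith
  have hb' : ∀ y ∈ T, ((T.filter fun z => ¬ G y z).card : ℝ) ≤ b := fun y hy => by
    refine le_trans (le_of_eq ?_) (hb y hy)
    congr 2
    exact Finset.filter_congr fun z _ => not_congr ⟨hG _ _, hG _ _⟩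
  -- the first point
  have e1 := le_seqE_eq (G := G) hT hb hb0 hM2 m hx (f := fun _ => 1) (fun _ => zero_le_one)
    (fun _ _ _ => rfl)
  rw [seqE_one hT hb hb0 hM2] at e1
  simp only [one_mul] at e1
  have s1 : (∑ j : Fin M, if j < m then
      seqE T G M (fun c => if ¬ G x (c j) then 1 else 0) else 0) ≤ M * (2 * b / T.card) := by
    refine (Finset.sum_le_card_nsmul _ _ (2 * b / T.card) fun j _ => ?_).trans (by simp)
    split_ifs
    · have h := seqE_fix_mem_le (G := G) hT hb hb0 hM2 ∅ (fun _ => x) (k := j) (by simp)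
        (T.filter fun z => ¬ G x z)
      refine le_trans (seqE_mono fun c hc => ?_) (h.trans ?_)
      · simp [hc j]
      · simp only [Finset.card_empty, pow_zero, one_mul]
        gcongr
        exact hb' x hx
    · positivity
  have e2 := le_seqE_eq (G := G) hT hb hb0 hM2 m' hy (f := fun c => if c m = x then 1 else 0)
    (fun c => by split_ifs <;> norm_num) (fun c c' h => by simp [h m hlt])
  have s2 : (∑ j : Fin M, if j < m' then seqE T G M (fun c => (if c m = x then 1 else 0) *
      if ¬ G y (c j) then 1 else 0) else 0) ≤ M * (2 / T.card * (2 * b / T.card)) := by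
    refine (Finset.sum_le_card_nsmul _ _ (2 / T.card * (2 * b / T.card)) fun j _ => ?_).trans
      (by simp)
    split_ifs
    · by_cases hj : j = m
      · subst hj
        refine le_trans (seqE_mono (g := fun _ => 0) fun c _ => ?_) ?_
        · by_cases hcx : c j = x
          · simp [hcx, hG _ _ hxy]
          · simp [hcx]
        · simp only [seqE, mul_zero, Finset.sum_const_zero]
          positivity
      · have h := seqE_fix_mem_le (G := G) hT hb hb0 hM2 {m} (fun _ => x) (k := j) (by simpa)
          (T.filter fun z => ¬ G y z)
        refine le_trans (seqE_mono fun c hc => ?_) (h.trans ?_)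
        · by_cases hcx : c m = x <;> simp [hc j, hcx]
        · simp only [Finset.card_singleton, pow_one]
          gcongr
          exact hb' y hy
    · positivity
  have e3 : seqE T G M (fun c => if c m = x ∧ c m' = y then 1 else 0) =
      seqE T G M (fun c => (if c m = x then 1 else 0) * if c m' = y then 1 else 0) :=
    seqE_congr fun c _ => by
      by_cases h1 : c m = x <;> by_cases h2 : c m' = y <;> simp [h1, h2]
  rw [e3]
  refine le_trans ?_ e2
  set p := seqE T G M (fun c => if c m = x then 1 else 0)
  have hp : (1 - M * (2 * b / T.card)) * (T.card : ℝ)⁻¹ ≤ p := le_trans (by gcongr) e1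
  have : ((1 - M * (2 * b / T.card)) * (T.card : ℝ)⁻¹ - M * (2 / T.card * (2 * b / T.card))) *
      (T.card : ℝ)⁻¹ ≤ (p - (∑ j : Fin M, if j < m' then seqE T G M (fun c =>
      (if c m = x then 1 else 0) * if ¬ G y (c j) then 1 else 0) else 0)) * (T.card : ℝ)⁻¹ := by
    gcongr
  refine le_trans ?_ this
  have hq : (M * b) / T.card ≤ 1 / 12 := by
    rw [div_le_div_iff₀ hT' (by norm_num)]; linarith
  have e4 : ((1 - M * (2 * b / T.card)) * (T.card : ℝ)⁻¹ - M * (2 / T.card * (2 * b / T.card))) *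
      (T.card : ℝ)⁻¹ = (1 - 6 * ((M * b) / T.card)) * ((T.card : ℝ) ^ 2)⁻¹ := by
    field_simp; ring
  rw [e4, mul_inv]
  gcongr
  norm_num
  linarith

lemma card_offDiag_fin (M : ℕ) :
    (((Finset.univ : Finset (Fin M)).offDiag.card : ℕ) : ℝ) = M * M - M := by
  rw [Finset.offDiag_card, Nat.cast_sub (Nat.le_mul_self _)]
  simp

lemma seqE_pairCount_pos_le {b : ℝ} (hT : 0 < T.card)
    (hb : ∀ y ∈ T, ((T.filter fun z => ¬ G z y).card : ℝ) ≤ b) (hb0 : 0 ≤ b) {M : ℕ}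
    (hM : 12 * (M * b) ≤ T.card) {A : X → X → Prop} {D : ℝ}
    (hA : ∀ x ∈ T, ((T.filter fun y => A x y).card : ℝ) ≤ D) :
    seqE T G M (fun c => if 1 ≤ pairCount A c then 1 else 0) ≤ 4 * ((M : ℝ) ^ 2 * (D / T.card)) := by
  have hMb : 0 ≤ (M : ℝ) * b := by positivity
  have hM2 : 2 * (M * b) ≤ T.card := by linarith
  have hD : 0 ≤ D := by
    obtain ⟨x, hx⟩ := Finset.card_pos.mp hT
    exact (Nat.cast_nonneg _).trans (hA x hx)
  have h1 : seqE T G M (fun c => if 1 ≤ pairCount A c then 1 else 0) ≤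
      seqE T G M (fun c => ∑ p ∈ (Finset.univ : Finset (Fin M)).offDiag,
        if A (c p.1) (c p.2) then 1 else 0) := by
    refine seqE_mono fun c _ => ?_
    rw [← pairCount_eq_sum]
    split_ifs with h
    · exact_mod_cast h
    · positivity
  rw [seqE_sum] at h1
  refine h1.trans ((Finset.sum_le_card_nsmul _ _ (4 * D / T.card) fun p hp =>
    seqE_rel_le hT hb hb0 hM2 hA (Finset.mem_offDiag.mp hp).2.2).trans ?_)
  rw [nsmul_eq_mul, card_offDiag_fin]
  have : (M * M - M : ℝ) * (4 * D / T.card) ≤ (M * M) * (4 * D / T.card) := by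
    gcongr
    linarith [(Nat.cast_nonneg M : (0 : ℝ) ≤ M)]
  refine this.trans (le_of_eq (by ring))

lemma seqE_pairCount_sq_le {b : ℝ} (hT : 0 < T.card)
    (hb : ∀ y ∈ T, ((T.filter fun z => ¬ G z y).card : ℝ) ≤ b) (hb0 : 0 ≤ b) {M : ℕ}
    (hM : 2 * (M * b) ≤ T.card) {A : X → X → Prop} {D : ℝ}
    (hA : ∀ x ∈ T, ((T.filter fun y => A x y).card : ℝ) ≤ D)
    (hA' : ∀ y ∈ T, ((T.filter fun x => A x y).card : ℝ) ≤ D) :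
    seqE T G M (fun c => (pairCount A c : ℝ) ^ 2) ≤
      8 * ((M : ℝ) ^ 2 * (D / T.card)) + 16 * ((M : ℝ) ^ 2 * (D / T.card)) ^ 2 := by
  have hD : 0 ≤ D := by
    obtain ⟨x, hx⟩ := Finset.card_pos.mp hT
    exact (Nat.cast_nonneg _).trans (hA x hx)
  set O := (Finset.univ : Finset (Fin M)).offDiag with hO
  have hOc : (O.card : ℝ) ≤ M ^ 2 := by
    rw [hO, card_offDiag_fin]
    nlinarith [(Nat.cast_nonneg M : (0 : ℝ) ≤ M)]
  have h1 : seqE T G M (fun c => (pairCount A c : ℝ) ^ 2) = ∑ p ∈ O, ∑ q ∈ O,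
      seqE T G M (fun c => if A (c p.1) (c p.2) ∧ A (c q.1) (c q.2) then 1 else 0) := by
    simp_rw [← seqE_sum]
    refine seqE_congr fun c _ => ?_
    rw [pairCount_eq_sum, sq, Finset.sum_mul_sum]
    refine Finset.sum_congr rfl fun p _ => Finset.sum_congr rfl fun q _ => ?_
    by_cases h1 : A (c p.1) (c p.2) <;> by_cases h2 : A (c q.1) (c q.2) <;> simp [h1, h2]
  rw [h1]
  have h2 : ∀ p ∈ O, ∑ q ∈ O,
      seqE T G M (fun c => if A (c p.1) (c p.2) ∧ A (c q.1) (c q.2) then 1 else 0) ≤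
      8 * (D / T.card) + M ^ 2 * (16 * (D / T.card) ^ 2) := by
    intro p hp
    have hp' := (Finset.mem_offDiag.mp hp).2.2
    have h3 : ∀ q ∈ O,
        seqE T G M (fun c => if A (c p.1) (c p.2) ∧ A (c q.1) (c q.2) then 1 else 0) ≤
        (if q = p then 4 * D / T.card else 0) + (if q = p.swap then 4 * D / T.card else 0) +
          16 * (D / T.card) ^ 2 := by
      intro q hq
      have hq' := (Finset.mem_offDiag.mp hq).2.2
      by_cases hpq : q = p ∨ q = p.swap
      · refine (le_trans (seqE_mono fun c _ => ?_) (seqE_rel_le (G := G) hT hb hb0 hM hA hp')).trans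
          ?_
        · split_ifs with u v
          · exact le_rfl
          · exact absurd u.1 v
          · norm_num
          · exact le_rfl
        · have h0 : 0 ≤ 4 * D / (T.card : ℝ) := by positivity
          have h0' : 0 ≤ 16 * (D / (T.card : ℝ)) ^ 2 := by positivity
          rcases hpq with h | h
          · rw [if_pos h]
            split_ifs <;> linarith
          · rw [if_pos h]
            split_ifs <;> linarith
      · push Not at hpq
        rw [if_neg hpq.1, if_neg hpq.2, zero_add, zero_add]
        refine seqE_rel_rel_le hT hb hb0 hM hA hA' hp' hq' (fun h => hpq.1 ?_)
          (fun h => hpq.2 ?_)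
        · exact Prod.ext h.1 h.2
        · exact Prod.ext h.1 h.2
    refine (Finset.sum_le_sum h3).trans ?_
    rw [Finset.sum_add_distrib, Finset.sum_add_distrib, Finset.sum_const, nsmul_eq_mul]
    have h4 : ∀ r : Fin M × Fin M, (∑ q ∈ O, if q = r then 4 * D / (T.card : ℝ) else 0) ≤
        4 * (D / T.card) := fun r => by
      rw [Finset.sum_ite_eq']
      split_ifs
      · exact le_of_eq (by ring)
      · positivity
    have h5 : (O.card : ℝ) * (16 * (D / T.card) ^ 2) ≤ M ^ 2 * (16 * (D / T.card) ^ 2) := by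
      gcongr
    linarith [h4 p, h4 p.swap]
  refine (Finset.sum_le_card_nsmul _ _ _ h2).trans ?_
  rw [nsmul_eq_mul]
  have : (O.card : ℝ) * (8 * (D / T.card) + M ^ 2 * (16 * (D / T.card) ^ 2)) ≤
      M ^ 2 * (8 * (D / T.card) + M ^ 2 * (16 * (D / T.card) ^ 2)) := by gcongr
  exact this.trans (le_of_eq (by ring))

lemma le_seqE_pairCount {b : ℝ} (hT : 0 < T.card) (hG : ∀ x y, G x y → G y x)
    (hb : ∀ y ∈ T, ((T.filter fun z => ¬ G z y).card : ℝ) ≤ b) (hb0 : 0 ≤ b) {M : ℕ}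
    (hM : 12 * (M * b) ≤ T.card) (hM1 : 2 ≤ M) {A : X → X → Prop} (hAG : ∀ x y, A x y → G x y)
    {K : ℝ} (hK : K ≤ (((T ×ˢ T).filter fun p => A p.1 p.2).card : ℝ)) :
    (M : ℝ) ^ 2 * (K / (T.card : ℝ) ^ 2) / 4 ≤ seqE T G M (fun c => (pairCount A c : ℝ)) := by
  have hT' : (0 : ℝ) < T.card := by exact_mod_cast hT
  simp_rw [pairCount_eq_sum]
  rw [seqE_sum]
  set K' := (T ×ˢ T).filter fun p => A p.1 p.2
  have h1 : ∀ p ∈ (Finset.univ : Finset (Fin M)).offDiag,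
      (K'.card : ℝ) * (2 * (T.card : ℝ) ^ 2)⁻¹ ≤
      seqE T G M (fun c => if A (c p.1) (c p.2) then 1 else 0) := by
    intro p hp
    have h2 : seqE T G M (fun c => ∑ q ∈ K', if c p.1 = q.1 ∧ c p.2 = q.2 then 1 else 0) ≤
        seqE T G M (fun c => if A (c p.1) (c p.2) then 1 else 0) := by
      refine seqE_mono fun c hc => le_of_eq ?_
      have : ∀ q : X × X, (c p.1 = q.1 ∧ c p.2 = q.2) ↔ (c p.1, c p.2) = q := fun q => by
        rw [Prod.ext_iff]
      simp only [this, Finset.sum_ite_eq]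
      simp [K', hc]
    refine le_trans ?_ h2
    rw [seqE_sum, ← nsmul_eq_mul]
    refine Finset.card_nsmul_le_sum _ _ _ fun q hq => ?_
    obtain ⟨hq1, hq2⟩ := Finset.mem_filter.mp hq
    obtain ⟨hq3, hq4⟩ := Finset.mem_product.mp hq1
    exact le_seqE_eq_eq hT hG hb hb0 hM hq3 hq4 (hAG _ _ hq2) (Finset.mem_offDiag.mp hp).2.2
  refine le_trans ?_ (Finset.card_nsmul_le_sum _ _ _ h1)
  rw [nsmul_eq_mul, card_offDiag_fin]
  have hM1' : (2 : ℝ) ≤ M := by exact_mod_cast hM1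
  have h3 : (M : ℝ) ^ 2 / 2 ≤ M * M - M := by nlinarith
  calc (M : ℝ) ^ 2 * (K / (T.card : ℝ) ^ 2) / 4
      ≤ (M : ℝ) ^ 2 * (K'.card / (T.card : ℝ) ^ 2) / 4 := by gcongr
    _ = (M : ℝ) ^ 2 / 2 * (K'.card * (2 * (T.card : ℝ) ^ 2)⁻¹) := by field_simp; ring
    _ ≤ _ := by gcongr

end PairCount

/-- Shannon entropy in nats. -/
def ent {A : Type} [Fintype A] (p : A → ℝ) : ℝ := -∑ a, p a * Real.log (p a)

section Types

variable {A α : Type} [Fintype A] [Fintype α]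

lemma sum_comp_eq_emp {n : ℕ} (hn : 0 < n) (x : Fin n → A) (f : A → ℝ) :
    ∑ i, f (x i) = n * ∑ a, emp n x a * f a := by
  have hn' : (n : ℝ) ≠ 0 := by exact_mod_cast hn.ne'
  rw [← Finset.sum_fiberwise (s := Finset.univ) (g := x), Finset.mul_sum]
  refine Finset.sum_congr rfl fun a _ => ?_
  rw [Finset.sum_congr rfl (g := fun _ => f a) fun i hi => by rw [(Finset.mem_filter.mp hi).2]]
  rw [Finset.sum_const, nsmul_eq_mul, emp]
  field_simp

lemma emp2_eq_emp {B : Type} [Fintype B] (n : ℕ) (x : Fin n → A) (y : Fin n → B) :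
    emp2 n x y = emp n (fun i => (x i, y i)) := by
  funext p
  simp [emp2, emp, Prod.ext_iff]

lemma emp2_swap (n : ℕ) (x y : Fin n → α) :
    emp2 n y x = fun p => emp2 n x y (p.2, p.1) := by
  funext p
  simp [emp2, and_comm]

lemma emp_apply_pos {n : ℕ} (hn : 0 < n) (x : Fin n → A) (i : Fin n) : 0 < emp n x (x i) := by
  have : 0 < (Finset.univ.filter fun j => x j = x i).card :=
    Finset.card_pos.mpr ⟨i, by simp⟩
  unfold emp
  positivity

lemma isDist_emp {n : ℕ} (hn : 0 < n) (x : Fin n → A) : IsDist (emp n x) := by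
  refine ⟨fun a => by unfold emp; positivity, ?_⟩
  have h := sum_comp_eq_emp hn x (fun _ => 1)
  have hn' : (n : ℝ) ≠ 0 := by exact_mod_cast hn.ne'
  simp only [Finset.sum_const, Finset.card_univ, Fintype.card_fin, nsmul_eq_mul, mul_one] at h
  exact (mul_left_cancel₀ hn' (by rw [mul_one]; exact h)).symm

lemma isTypeDist_emp {n : ℕ} (hn : 0 < n) (x : Fin n → A) : IsTypeDist n (emp n x) := by
  have hn' : (n : ℝ) ≠ 0 := by exact_mod_cast hn.ne'
  exact fun a => ⟨_, div_mul_cancel₀ _ hn'⟩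

lemma sum_emp2_right {n : ℕ} (x y : Fin n → α) (a : α) : ∑ b, emp2 n x y (a, b) = emp n x a := by
  simp only [emp2, emp]
  rw [← Finset.sum_div, ← Nat.cast_sum]
  congr 2
  rw [Finset.card_eq_sum_card_fiberwise (f := y) (t := Finset.univ) (fun _ _ => by simp)]
  simp [Finset.filter_filter]

lemma sum_emp2_left {n : ℕ} (x y : Fin n → α) (b : α) : ∑ a, emp2 n x y (a, b) = emp n y b := by
  rw [← sum_emp2_right y x b, emp2_swap n x y]

lemma joint_emp2 {n : ℕ} (hn : 0 < n) {Q : α → ℝ} {x y : Fin n → α} (hx : emp n x = Q)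
    (hy : emp n y = Q) : Joint Q (emp2 n x y) :=
  ⟨emp2_eq_emp n x y ▸ isDist_emp hn _, fun a => by rw [sum_emp2_right, hx],
    fun b => by rw [sum_emp2_left, hy]⟩

lemma Joint.swap {Q : α → ℝ} {P : α × α → ℝ} (h : Joint Q P) :
    Joint Q (fun p => P (p.2, p.1)) := by
  refine ⟨⟨fun p => h.1.1 _, ?_⟩, h.2.2, h.2.1⟩
  rw [← h.1.2]
  exact Equiv.sum_comp (Equiv.prodComm α α) P

lemma Joint.le_left {Q : α → ℝ} {P : α × α → ℝ} (h : Joint Q P) (p : α × α) : P p ≤ Q p.1 := by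
  rw [← h.2.1 p.1]
  exact Finset.single_le_sum (f := fun b => P (p.1, b)) (fun b _ => h.1.1 _) (Finset.mem_univ p.2)

lemma Joint.le_right {Q : α → ℝ} {P : α × α → ℝ} (h : Joint Q P) (p : α × α) : P p ≤ Q p.2 :=
  h.swap.le_left (p.2, p.1)

lemma ent_swap (P : α × α → ℝ) : ent (fun p : α × α => P (p.2, p.1)) = ent P := by
  unfold ent
  rw [← Equiv.sum_comp (Equiv.prodComm α α) fun p => P p * Real.log (P p)]
  rfl

lemma Joint.sum_mul_log_left {Q : α → ℝ} {P : α × α → ℝ} (h : Joint Q P) :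
    ∑ p : α × α, P p * Real.log (Q p.1) = -ent Q := by
  rw [ent, neg_neg, Fintype.sum_prod_type]
  refine Finset.sum_congr rfl fun a _ => ?_
  simp only
  rw [← Finset.sum_mul, h.2.1]

lemma Joint.sum_mul_log_right {Q : α → ℝ} {P : α × α → ℝ} (h : Joint Q P) :
    ∑ p : α × α, P p * Real.log (Q p.2) = -ent Q := by
  rw [← h.swap.sum_mul_log_left,
    ← Equiv.sum_comp (Equiv.prodComm α α) fun p => P p * Real.log (Q p.2)]
  rfl

lemma Joint.mutInf_eq {Q : α → ℝ} {P : α × α → ℝ} (h : Joint Q P) :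
    mutInf P = 2 * ent Q - ent P := by
  have h1 : mutInf P = ∑ p : α × α, (P p * Real.log (P p) - P p * Real.log (Q p.1) -
      P p * Real.log (Q p.2)) := by
    refine Finset.sum_congr rfl fun p _ => ?_
    rw [h.2.1, h.2.2]
    rcases (h.1.1 p).eq_or_lt with h0 | h0
    · simp [← h0]
    · have h1 := h0.trans_le (h.le_left p)
      have h2 := h0.trans_le (h.le_right p)
      rw [Real.log_div h0.ne' (mul_pos h1 h2).ne', Real.log_mul h1.ne' h2.ne']
      ring
  rw [h1, Finset.sum_sub_distrib, Finset.sum_sub_distrib, h.sum_mul_log_left,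
    h.sum_mul_log_right, ent, ent]
  ring

lemma card_mul_le_one {n : ℕ} (S : Finset (Fin n → A)) (V : Fin n → A → ℝ)
    (hV0 : ∀ i a, 0 ≤ V i a) (hV1 : ∀ i, ∑ a, V i a ≤ 1) {r : ℝ}
    (hr : ∀ y ∈ S, r ≤ ∏ i, V i (y i)) : S.card * r ≤ 1 := by
  rw [← nsmul_eq_mul]
  calc S.card • r ≤ ∑ y ∈ S, ∏ i, V i (y i) := Finset.card_nsmul_le_sum _ _ _ hr
    _ ≤ ∑ y : Fin n → A, ∏ i, V i (y i) :=
        Finset.sum_le_sum_of_subset_of_nonneg (Finset.subset_univ _)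
          fun y _ _ => Finset.prod_nonneg fun i _ => hV0 i _
    _ = ∏ i, ∑ a, V i a := (Fintype.prod_sum _).symm
    _ ≤ 1 := Finset.prod_le_one (fun i _ => Finset.sum_nonneg fun a _ => hV0 i a) fun i _ => hV1 i

lemma typeClass_card_le {n : ℕ} (hn : 0 < n) {Q : A → ℝ} (hQ : IsDist Q) :
    ((typeClass n Q).card : ℝ) ≤ Real.exp (n * ent Q) := by
  have h := card_mul_le_one (typeClass n Q) (fun _ => Q) (fun _ => hQ.1) (fun _ => hQ.2.le)
    (r := Real.exp (-(n * ent Q))) fun y hy => ?_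
  · rw [Real.exp_neg, ← div_eq_mul_inv, div_le_one (Real.exp_pos _)] at h
    exact h
  · have hy' : emp n y = Q := (Finset.mem_filter.mp hy).2
    have hpos : ∀ i, 0 < Q (y i) := fun i => hy' ▸ emp_apply_pos hn y i
    rw [← Real.exp_log (Finset.prod_pos fun i _ => hpos i),
      Real.log_prod fun i _ => (hpos i).ne',
      sum_comp_eq_emp hn y fun a => Real.log (Q a), hy', ent]
    simp

/-- The number of sequences in a conditional type class. -/
lemma condType_card_le {n : ℕ} (hn : 0 < n) {Q : α → ℝ} {P : α × α → ℝ} (hP : Joint Q P)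
    (x : Fin n → α) :
    ((Finset.univ.filter fun y : Fin n → α => emp2 n x y = P).card : ℝ) ≤
      Real.exp (n * (ent P - ent Q)) := by
  have hQ0 : ∀ a, 0 ≤ Q a := fun a => hP.2.1 a ▸ Finset.sum_nonneg fun b _ => hP.1.1 _
  have h := card_mul_le_one (Finset.univ.filter fun y : Fin n → α => emp2 n x y = P)
    (fun i b => P (x i, b) / Q (x i)) (fun i b => div_nonneg (hP.1.1 _) (hQ0 _))
    (fun i => by
      rw [← Finset.sum_div, hP.2.1]
      exact div_self_le_one _)
    (r := Real.exp (-(n * (ent P - ent Q)))) fun y hy => ?_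
  · rw [Real.exp_neg, ← div_eq_mul_inv, div_le_one (Real.exp_pos _)] at h
    exact h
  · have hy' : emp n (fun i => (x i, y i)) = P := by
      rw [← emp2_eq_emp]; exact (Finset.mem_filter.mp hy).2
    have hpos : ∀ i, 0 < P (x i, y i) := fun i =>
      hy' ▸ emp_apply_pos hn (fun i => (x i, y i)) i
    have hposQ : ∀ i, 0 < Q (x i) := fun i => (hpos i).trans_le (hP.le_left (x i, y i))
    have hpos' : ∀ i, 0 < P (x i, y i) / Q (x i) := fun i => div_pos (hpos i) (hposQ i)
    rw [← Real.exp_log (Finset.prod_pos fun i _ => hpos' i),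
      Real.log_prod fun i _ => (hpos' i).ne']
    have h1 : ∑ i, Real.log (P (x i, y i) / Q (x i)) =
        ∑ i, (Real.log (P (x i, y i)) - Real.log (Q (x i))) :=
      Finset.sum_congr rfl fun i _ => Real.log_div (hpos i).ne' (hposQ i).ne'
    rw [h1, sum_comp_eq_emp hn (fun i => (x i, y i)) fun p => Real.log (P p) - Real.log (Q p.1),
      hy']
    simp_rw [mul_sub]
    rw [Finset.sum_sub_distrib, hP.sum_mul_log_left, ent, ← mul_sub]
    exact le_of_eq (by ring_nf)

lemma sub_le_log_factorial (n : ℕ) : n * Real.log n - n ≤ Real.log n.factorial := by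
  induction n with
  | zero => simp
  | succ n ih =>
    rw [Nat.factorial_succ, Nat.cast_mul, Real.log_mul (by positivity) (by positivity)]
    rcases Nat.eq_zero_or_pos n with rfl | hn
    · norm_num
    · have hn' : (0 : ℝ) < n := by exact_mod_cast hn
      have h := Real.log_le_sub_one_of_pos (x := ((n : ℝ) + 1) / n) (by positivity)
      rw [Real.log_div (by positivity) (by positivity)] at h
      have h2 : n * (Real.log (n + 1) - Real.log n) ≤ 1 := by
        calc n * (Real.log (n + 1) - Real.log n) ≤ n * (((n : ℝ) + 1) / n - 1) := by gcongr
          _ = 1 := by field_simp; ring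
      push_cast
      nlinarith

lemma log_factorial_le (k : ℕ) :
    Real.log k.factorial ≤ Real.log (k + 1) + 1 + k * Real.log k - k := by
  have key : ∀ k : ℕ, 0 < k → Real.log k.factorial ≤ Real.log k + 1 + k * Real.log k - k := by
    intro k hk
    induction k, hk using Nat.le_induction with
    | base => norm_num
    | succ n hn ih =>
      have hn' : (0 : ℝ) < n := by exact_mod_cast hn
      rw [Nat.factorial_succ, Nat.cast_mul, Real.log_mul (by positivity) (by positivity)]
      have h := Real.one_sub_inv_le_log_of_pos (x := ((n : ℝ) + 1) / n) (by positivity)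
      rw [Real.log_div (by positivity) (by positivity)] at h
      have h2 : 1 ≤ ((n : ℝ) + 1) * (Real.log (n + 1) - Real.log n) := by
        calc (1 : ℝ) = ((n : ℝ) + 1) * (1 - (((n : ℝ) + 1) / n)⁻¹) := by field_simp; ring
          _ ≤ _ := by gcongr
      push_cast
      nlinarith
  rcases Nat.eq_zero_or_pos k with rfl | hk
  · norm_num
  · refine (key k hk).trans ?_
    have hk' : (0 : ℝ) < k := by exact_mod_cast hk
    have := Real.log_le_log hk' (by linarith : (k : ℝ) ≤ k + 1)
    linarith

lemma typeClass_nonempty {n : ℕ} (hn : 0 < n) {p : A → ℝ} (hp : IsDist p)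
    (hpn : IsTypeDist n p) : (typeClass n p).Nonempty := by
  choose k hk using hpn
  have hn' : (n : ℝ) ≠ 0 := by exact_mod_cast hn.ne'
  have hsum : ∑ a, k a = n := by
    have : ((∑ a, k a : ℕ) : ℝ) = n := by
      push_cast
      simp_rw [← hk]
      rw [← Finset.sum_mul, hp.2, one_mul]
    exact_mod_cast this
  have hcard : Fintype.card (Fin n) = Fintype.card (Σ a, Fin (k a)) := by simp [hsum]
  let e : Fin n ≃ Σ a, Fin (k a) := Fintype.equivOfCardEq hcard
  refine ⟨fun i => (e i).1, Finset.mem_filter.mpr ⟨Finset.mem_univ _, ?_⟩⟩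
  funext a
  have h1 : (Finset.univ.filter fun i => (e i).1 = a).card = k a := by
    rw [← Fintype.card_subtype, Fintype.card_congr (e.subtypeEquiv (q := fun s => s.1 = a)
      fun _ => Iff.rfl), Fintype.card_congr (Equiv.sigmaSubtype a), Fintype.card_fin]
  rw [emp, h1, ← hk, mul_div_cancel_right₀ _ hn']

lemma factorial_le_typeClass_card {n : ℕ} (x : Fin n → A) :
    n.factorial ≤ (typeClass n (emp n x)).card *
      ∏ a, ((Finset.univ.filter fun i => x i = a).card).factorial := by
  have hst : (Finset.univ.filter fun g : Equiv.Perm (Fin n) => x ∘ g = x).card =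
      ∏ a, ((Finset.univ.filter fun i => x i = a).card).factorial := by
    rw [← Fintype.card_subtype]
    convert DomMulAct.stabilizer_card x using 3 with a
    rw [Fintype.card_subtype]
  rw [← hst]
  have hmap : ∀ g ∈ (Finset.univ : Finset (Equiv.Perm (Fin n))),
      x ∘ g ∈ typeClass n (emp n x) := fun g _ => by
    refine Finset.mem_filter.mpr ⟨Finset.mem_univ _, funext fun a => ?_⟩
    unfold emp
    congr 2
    exact Finset.card_bij (fun i _ => g i) (by simp) (by simp)
      fun i hi => ⟨g.symm i, by simpa using hi, by simp⟩
  calc n.factorial = (Finset.univ : Finset (Equiv.Perm (Fin n))).card := by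
        rw [Finset.card_univ, Fintype.card_perm, Fintype.card_fin]
    _ = ∑ y ∈ typeClass n (emp n x),
          (Finset.univ.filter fun g : Equiv.Perm (Fin n) => x ∘ g = y).card :=
        Finset.card_eq_sum_card_fiberwise hmap
    _ ≤ _ := by
      rw [← smul_eq_mul]
      refine Finset.sum_le_card_nsmul _ _ _ fun y _ => ?_
      by_cases h : ∃ g₀ : Equiv.Perm (Fin n), x ∘ g₀ = y
      · obtain ⟨g₀, rfl⟩ := h
        refine Finset.card_le_card_of_injOn (fun g => g * g₀⁻¹) (fun g hg => ?_)
          fun g _ g' _ h => mul_right_cancel h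
        have hg' : x ∘ g = x ∘ g₀ := by simpa using hg
        simp only [Finset.coe_filter, Finset.mem_univ, true_and, Set.mem_ofPred_eq]
        funext i
        simpa using congrFun hg' (g₀⁻¹ i)
      · push Not at h
        rw [Finset.filter_eq_empty_iff.mpr fun g _ => h g]
        simp

lemma le_typeClass_card {n : ℕ} (hn : 0 < n) {p : A → ℝ} (hp : IsDist p)
    (hpn : IsTypeDist n p) :
    Real.exp (n * ent p) ≤
      (typeClass n p).card * (3 * ((n : ℝ) + 1)) ^ Fintype.card A := by
  obtain ⟨x, hx⟩ := typeClass_nonempty hn hp hpn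
  have hx' : emp n x = p := (Finset.mem_filter.mp hx).2
  have hT : (0 : ℝ) < (typeClass n p).card := by exact_mod_cast Finset.card_pos.mpr ⟨x, hx⟩
  have hn' : (0 : ℝ) < n := by exact_mod_cast hn
  have h1 := factorial_le_typeClass_card x
  rw [hx'] at h1
  set k : A → ℕ := fun a => (Finset.univ.filter fun i => x i = a).card with hk
  have hkp : ∀ a, (k a : ℝ) = n * p a := fun a => by
    rw [← hx', emp]; field_simp; rfl
  have h2 : Real.log n.factorial ≤ Real.log (typeClass n p).card +
      ∑ a, Real.log (k a).factorial := by
    rw [← Real.log_prod fun a _ => by positivity, ← Real.log_mul hT.ne'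
      (Finset.prod_ne_zero_iff.mpr fun a _ => by positivity)]
    refine Real.log_le_log (by positivity) ?_
    exact_mod_cast h1
  have h3 : ∀ a, Real.log (k a).factorial ≤ Real.log (3 * ((n : ℝ) + 1)) +
      (n * Real.log n - n) * p a + n * (p a * Real.log (p a)) := fun a => by
    refine (log_factorial_le (k a)).trans ?_
    have hkn : (k a : ℝ) ≤ n := by
      have : k a ≤ n := (Finset.card_le_univ _).trans (by simp)
      exact_mod_cast this
    have h4 : Real.log (k a + 1) ≤ Real.log (n + 1) := Real.log_le_log (by positivity) (by linarith)
    have h5 : (1 : ℝ) ≤ Real.log 3 := by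
      rw [Real.le_log_iff_exp_le (by norm_num)]
      linarith [Real.exp_one_lt_d9]
    rw [Real.log_mul (by norm_num) (by positivity)]
    have h6 : (k a : ℝ) * Real.log (k a) - k a =
        (n * Real.log n - n) * p a + n * (p a * Real.log (p a)) := by
      rcases (hp.1 a).eq_or_lt with h0 | h0
      · simp [hkp, ← h0]
      · rw [hkp, Real.log_mul hn'.ne' h0.ne']
        ring
    linarith
  have h4 := h2.trans (add_le_add_right (Finset.sum_le_sum fun a _ => h3 a) _)
  rw [Finset.sum_add_distrib, Finset.sum_add_distrib, ← Finset.mul_sum, ← Finset.mul_sum, hp.2,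
    Finset.sum_const, Finset.card_univ, nsmul_eq_mul] at h4
  have h5 := sub_le_log_factorial n
  have h6 : n * ent p ≤ Real.log (typeClass n p).card +
      Fintype.card A * Real.log (3 * ((n : ℝ) + 1)) := by
    unfold ent
    linarith
  rw [← Real.log_pow, ← Real.log_mul hT.ne' (by positivity)] at h6
  exact (Real.le_log_iff_exp_le (by positivity)).mp h6

lemma le_typeClass2_card {n : ℕ} (hn : 0 < n) {P : α × α → ℝ} (hP : IsDist P)
    (hPn : IsTypeDist n P) :
    Real.exp (n * ent P) ≤
      (typeClass2 n P).card * (3 * ((n : ℝ) + 1)) ^ Fintype.card (α × α) := by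
  have h : (typeClass2 n P).card = (typeClass n P).card := by
    refine Finset.card_bij (fun xx _ i => (xx.1 i, xx.2 i)) (fun xx h => ?_) (fun xx _ yy _ h => ?_)
      fun z hz => ⟨(fun i => (z i).1, fun i => (z i).2), ?_, rfl⟩
    · simpa [typeClass2, typeClass, emp2_eq_emp] using h
    · refine Prod.ext (funext fun i => ?_) (funext fun i => ?_)
      · exact (Prod.ext_iff.mp (congrFun h i)).1
      · exact (Prod.ext_iff.mp (congrFun h i)).2
    · simpa [typeClass2, typeClass, emp2_eq_emp] using hz
  rw [h]
  exact le_typeClass_card hn hP hPn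

/-- There are at most `(n + 1) ^ #A` empirical distributions. -/
lemma card_image_emp_le (n : ℕ) (s : Finset (Fin n → A)) :
    (s.image (emp n)).card ≤ (n + 1) ^ Fintype.card A := by
  have hsub : s.image (emp n) ⊆
      (Finset.univ : Finset (A → Fin (n + 1))).image fun k a => ((k a : ℕ) : ℝ) / n := by
    intro p hp
    obtain ⟨x, _, rfl⟩ := Finset.mem_image.mp hp
    refine Finset.mem_image.mpr ⟨fun a => ⟨(Finset.univ.filter fun i => x i = a).card,
      Nat.lt_succ_of_le ((Finset.card_le_univ _).trans (by simp))⟩, Finset.mem_univ _, rfl⟩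
  refine (Finset.card_le_card hsub).trans (Finset.card_image_le.trans ?_)
  simp

end Types

section Ensemble

variable {α : Type} [Fintype α]

lemma RateCond.le_mutInf {n : ℕ} {Q : α → ℝ} {d : (α × α → ℝ) → ℝ} {Δ R δ : ℝ}
    (h : RateCond n Q d Δ R δ) {P : α × α → ℝ} (hP : Joint Q P) (hPn : IsTypeDist n P)
    (hd : d P ≤ Δ) : R + 2 * δ ≤ mutInf P := by
  have h1 : ((R : ℝ) : EReal) ≤ ((mutInf P : ℝ) : EReal) - ((2 * δ : ℝ) : EReal) :=
    h.trans (EReal.sub_le_sub (sInf_le ⟨P, hP, hPn, hd, rfl⟩) le_rfl)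
  rw [← EReal.coe_sub, EReal.coe_le_coe_iff] at h1
  linarith

lemma card_excluded_le {n : ℕ} (hn : 0 < n) {Q : α → ℝ} {d : (α × α → ℝ) → ℝ}
    (hd : IsDistance d) {Δ R δ : ℝ} (hrate : RateCond n Q d Δ R δ) {y : Fin n → α}
    (hy : y ∈ typeClass n Q) :
    (((typeClass n Q).filter fun z => ¬ Δ < d (emp2 n z y)).card : ℝ) ≤
      ((n : ℝ) + 1) ^ Fintype.card (α × α) * Real.exp (n * (ent Q - R - 2 * δ)) := by
  set S := (typeClass n Q).filter fun z => ¬ Δ < d (emp2 n z y) with hS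
  have hy' : emp n y = Q := (Finset.mem_filter.mp hy).2
  have h1 : S.card = ∑ p ∈ S.image (fun z => emp2 n y z),
      (S.filter fun z => emp2 n y z = p).card :=
    Finset.card_eq_sum_card_image _ _
  have h2 : (S.image (fun z => emp2 n y z)).card ≤ (n + 1) ^ Fintype.card (α × α) := by
    refine le_trans (le_of_eq ?_) (card_image_emp_le n (S.image fun z i => (y i, z i)))
    rw [Finset.image_image]
    congr 1
    exact Finset.image_congr fun z _ => emp2_eq_emp n y z
  have h3 : ∀ p ∈ S.image (fun z => emp2 n y z),
      ((S.filter fun z => emp2 n y z = p).card : ℝ) ≤ Real.exp (n * (ent Q - R - 2 * δ)) := by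
    intro p hp
    obtain ⟨z, hz, rfl⟩ := Finset.mem_image.mp hp
    obtain ⟨hzT, hzd⟩ := Finset.mem_filter.mp hz
    have hJ := joint_emp2 hn hy' (Finset.mem_filter.mp hzT).2
    have hI := hrate.le_mutInf hJ (emp2_eq_emp n y z ▸ isTypeDist_emp hn _) (by
      have := hd.2 (emp2 n y z)
      rw [← emp2_swap n y z] at this
      linarith)
    rw [hJ.mutInf_eq] at hI
    refine le_trans ?_ ((condType_card_le hn hJ y).trans ?_)
    · exact_mod_cast Finset.card_le_card (Finset.filter_subset_filter _ (Finset.subset_univ _))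
    · exact Real.exp_le_exp.mpr (mul_le_mul_of_nonneg_left (by linarith) (Nat.cast_nonneg n))
  rw [h1, Nat.cast_sum]
  refine (Finset.sum_le_card_nsmul _ _ _ h3).trans ?_
  rw [nsmul_eq_mul]
  gcongr
  exact_mod_cast h2

lemma rgvProb_eq_seqProb (n : ℕ) (Q : α → ℝ) (d : (α × α → ℝ) → ℝ) (Δ : ℝ) {M : ℕ}
    (c : Fin M → Fin n → α) :
    rgvProb n Q d Δ c = seqProb (typeClass n Q) (fun z y => Δ < d (emp2 n z y)) c := by
  unfold rgvProb seqProb feasible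
  refine Finset.prod_congr rfl fun i _ => ?_
  congr!

lemma prob_eq_seqE (n : ℕ) (Q : α → ℝ) (d : (α × α → ℝ) → ℝ) (Δ : ℝ) (M : ℕ)
    (P : α × α → ℝ) :
    prob n Q d Δ M (fun c => 1 ≤ Nenum n P c) =
      seqE (typeClass n Q) (fun z y => Δ < d (emp2 n z y)) M
        (fun c => if 1 ≤ pairCount (fun x y => emp2 n x y = P) c then 1 else 0) := by
  refine Finset.sum_congr rfl fun c _ => ?_
  rw [rgvProb_eq_seqProb, mul_ite, mul_one, mul_zero]
  have h : Nenum n P c = pairCount (fun x y => emp2 n x y = P) c := by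
    unfold Nenum pairCount
    congr!
  simp only [h]

set_option maxHeartbeats 400000 in
/-- Non-asymptotic two-sided bounds on the probability that the type enumerator is positive. -/
lemma prob_Nenum_bounds {n : ℕ} (hn : 0 < n) {Q : α → ℝ} (hQ : IsDist Q) (hQn : IsTypeDist n Q)
    {d : (α × α → ℝ) → ℝ} (hd : IsDistance d) {Δ R δ : ℝ} (hR : 0 < R) {P : α × α → ℝ}
    (hP : Joint Q P) (hPn : IsTypeDist n P) (hPI : 2 * R ≤ mutInf P) (hPd : Δ < d P)
    (hrate : RateCond n Q d Δ R δ) {p : ℝ}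
    (hp : p = (3 * ((n : ℝ) + 1)) ^ (Fintype.card α + Fintype.card (α × α)))
    (hlarge : 24 * p * Real.exp (-(2 * δ * n)) ≤ 1) :
    Real.exp (n * (2 * R - mutInf P)) / (1152 * p ^ 4) ≤
        prob n Q d Δ (Mof R n) (fun c => 1 ≤ Nenum n P c) ∧
      prob n Q d Δ (Mof R n) (fun c => 1 ≤ Nenum n P c) ≤
        16 * p * Real.exp (n * (2 * R - mutInf P)) := by
  have hn' : (0 : ℝ) < n := by exact_mod_cast hn
  set T := typeClass n Q with hTdef
  set N : ℝ := (T.card : ℝ) with hN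
  set M := Mof R n with hMdef
  set r : ℝ := 3 * ((n : ℝ) + 1) with hr
  have hr1 : 1 ≤ r := by linarith
  set p₁ := r ^ Fintype.card α with hp₁
  set p₂ := r ^ Fintype.card (α × α) with hp₂
  have hp12 : p = p₁ * p₂ := by rw [hp, pow_add]
  have hp₁1 : 1 ≤ p₁ := one_le_pow₀ hr1
  have hp₂1 : 1 ≤ p₂ := one_le_pow₀ hr1
  have hp1 : 1 ≤ p := by rw [hp12]; exact one_le_mul_of_one_le_of_one_le hp₁1 hp₂1
  have hpp₁ : p₁ ≤ p := by rw [hp12]; exact le_mul_of_one_le_right (by linarith) hp₂1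
  have hpp₂ : p₂ ≤ p := by rw [hp12]; exact le_mul_of_one_le_left (by linarith) hp₁1
  have hT : 0 < T.card := Finset.card_pos.mpr (typeClass_nonempty hn hQ hQn)
  have hN0 : 0 < N := Nat.cast_pos.mpr hT
  have hNge : Real.exp (n * ent Q) ≤ N * p₁ := le_typeClass_card hn hQ hQn
  have hNle : N ≤ Real.exp (n * ent Q) := typeClass_card_le hn hQ
  have hKge : Real.exp (n * ent P) ≤ (typeClass2 n P).card * p₂ :=
    le_typeClass2_card hn hP.1 hPn
  have hI := hP.mutInf_eq
  -- the number of codewords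
  have hexp1 : 1 < Real.exp (n * R) := Real.one_lt_exp_iff.mpr (by positivity)
  have hMge : Real.exp (n * R) ≤ M := Nat.le_ceil _
  have hMle : (M : ℝ) ≤ 2 * Real.exp (n * R) := by
    have := Nat.ceil_lt_add_one (Real.exp_pos (n * R)).le
    have h' : (M : ℝ) < Real.exp (n * R) + 1 := this
    linarith
  have hM2 : 2 ≤ M := by
    have : (1 : ℝ) < M := hexp1.trans_le hMge
    exact_mod_cast this
  -- the compatibility relation and the relation counted by the enumerator
  obtain ⟨G, hGdef⟩ : ∃ G : (Fin n → α) → (Fin n → α) → Prop,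
      G = fun z y => Δ < d (emp2 n z y) := ⟨_, rfl⟩
  obtain ⟨A, hAdef⟩ : ∃ A : (Fin n → α) → (Fin n → α) → Prop,
      A = fun x y => emp2 n x y = P := ⟨_, rfl⟩
  have hGiff : ∀ x y, G x y ↔ Δ < d (emp2 n x y) := fun x y => by rw [hGdef]
  have hAiff : ∀ x y, A x y ↔ emp2 n x y = P := fun x y => by rw [hAdef]
  set b : ℝ := ((n : ℝ) + 1) ^ Fintype.card (α × α) * Real.exp (n * (ent Q - R - 2 * δ)) with hbdef
  have hb0 : 0 ≤ b := by positivity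
  have hb : ∀ y ∈ T, ((T.filter fun z => ¬ G z y).card : ℝ) ≤ b := fun y hy => by
    simp only [hGiff]
    exact card_excluded_le hn hd hrate hy
  have hMb : 12 * (M * b) ≤ N := by
    have h1 : ((n : ℝ) + 1) ^ Fintype.card (α × α) ≤ p₂ := by
      rw [hp₂]; gcongr; linarith
    have h2 : Real.exp (n * (ent Q - R - 2 * δ)) =
        Real.exp (n * ent Q) * Real.exp (-(2 * δ * n)) * (Real.exp (n * R))⁻¹ := by
      rw [← Real.exp_neg, ← Real.exp_add, ← Real.exp_add]; ring_nf
    calc 12 * (M * b) ≤ 12 * ((2 * Real.exp (n * R)) * (p₂ * ((N * p₁) *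
          Real.exp (-(2 * δ * n)) * (Real.exp (n * R))⁻¹))) := by
          rw [hbdef, h2]; gcongr
      _ = N * (24 * p * Real.exp (-(2 * δ * n))) := by
          rw [hp12]; field_simp; ring
      _ ≤ N * 1 := by gcongr
      _ = N := mul_one N
  -- degrees of the relation
  set L : ℝ := Real.exp (-(n * mutInf P)) with hL
  set E : ℝ := Real.exp (n * (ent P - ent Q)) with hE
  have hA : ∀ x ∈ T, ((T.filter fun y => A x y).card : ℝ) ≤ E := fun x _ => by
    simp only [hAiff]
    refine le_trans ?_ (condType_card_le hn hP x)
    exact_mod_cast Finset.card_le_card (Finset.filter_subset_filter _ (Finset.subset_univ _))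
  have hA' : ∀ y ∈ T, ((T.filter fun x => A x y).card : ℝ) ≤ E := fun y _ => by
    have h := condType_card_le hn hP.swap y
    rw [ent_swap] at h
    refine le_trans ?_ h
    have : (T.filter fun x => A x y) ⊆
        Finset.univ.filter fun x => emp2 n y x = fun q => P (q.2, q.1) := fun x hx => by
      refine Finset.mem_filter.mpr ⟨Finset.mem_univ _, ?_⟩
      rw [emp2_swap n x y, (hAiff x y).mp (Finset.mem_filter.mp hx).2]
    exact_mod_cast Finset.card_le_card this
  have hEN : E / N ≤ p * L := by
    rw [div_le_iff₀ hN0]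
    have h1 : E = L * Real.exp (n * ent Q) := by
      rw [hE, hL, ← Real.exp_add, hI]; ring_nf
    calc E ≤ L * (N * p₁) := by rw [h1]; gcongr
      _ ≤ L * (N * p) := by gcongr
      _ = p * L * N := by ring
  have hK : ((typeClass2 n P).card : ℝ) ≤
      (((T ×ˢ T).filter fun q => A q.1 q.2).card : ℝ) := by
    have : typeClass2 n P ⊆ (T ×ˢ T).filter fun q => A q.1 q.2 := fun q hq => by
      have hq' : emp2 n q.1 q.2 = P := (Finset.mem_filter.mp hq).2
      refine Finset.mem_filter.mpr ⟨Finset.mem_product.mpr ⟨Finset.mem_filter.mpr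
        ⟨Finset.mem_univ _, funext fun a => ?_⟩, Finset.mem_filter.mpr
        ⟨Finset.mem_univ _, funext fun a => ?_⟩⟩, (hAiff _ _).mpr hq'⟩
      · rw [← sum_emp2_right q.1 q.2, hq', hP.2.1]
      · rw [← sum_emp2_left q.1 q.2, hq', hP.2.2]
    exact_mod_cast Finset.card_le_card this
  have hKN : L / p ≤ (typeClass2 n P).card / N ^ 2 := by
    rw [div_le_div_iff₀ (by linarith) (by positivity)]
    have h1 : L * Real.exp (n * ent Q) ^ 2 = Real.exp (n * ent P) := by
      rw [hL, sq, ← Real.exp_add, ← Real.exp_add, hI]; ring_nf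
    calc L * N ^ 2 ≤ L * Real.exp (n * ent Q) ^ 2 := by gcongr
      _ ≤ (typeClass2 n P).card * p₂ := by rw [h1]; exact hKge
      _ ≤ _ := by gcongr
  -- moments
  have hG : ∀ x y, G x y → G y x := fun x y h => by
    rw [hGiff] at h ⊢
    rwa [emp2_swap n x y, hd.2]
  rw [prob_eq_seqE, ← hGdef, ← hAdef, ← hTdef]
  have hup := seqE_pairCount_pos_le (G := G) hT hb hb0 hMb hA
  have hsq := seqE_pairCount_sq_le (G := G) (M := M) hT hb hb0
    (by linarith [mul_nonneg (Nat.cast_nonneg M : (0 : ℝ) ≤ M) hb0]) hA hA'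
  have hlow := le_seqE_pairCount (G := G) hT hG hb hb0 hMb hM2
    (A := A) (fun x y h => (hGiff x y).mpr (by rw [(hAiff x y).mp h]; exact hPd)) hK
  have hcs := seqE_sq_le (T := T) (G := G) (M := M)
    (fun c => (pairCount A c : ℝ))
  simp only [ne_eq, Nat.cast_eq_zero, ← Nat.one_le_iff_ne_zero] at hcs
  set π := seqE T G M
    (fun c => if 1 ≤ pairCount A c then 1 else 0)
  have hπ0 : 0 ≤ π := seqE_nonneg fun c => by split_ifs <;> norm_num
  set s : ℝ := (M : ℝ) ^ 2 * L with hs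
  have hL0 : 0 < L := Real.exp_pos _
  have hs0 : 0 < s := by positivity
  have hexp : Real.exp (n * (2 * R - mutInf P)) = Real.exp (n * R) ^ 2 * L := by
    rw [hL, sq, ← Real.exp_add, ← Real.exp_add]; ring_nf
  have hsle : s ≤ 4 * Real.exp (n * (2 * R - mutInf P)) := by
    calc s ≤ (2 * Real.exp (n * R)) ^ 2 * L := by rw [hs]; gcongr
      _ = _ := by rw [hexp]; ring
  have hsge : Real.exp (n * (2 * R - mutInf P)) ≤ s := by
    rw [hexp, hs]; gcongr
  have hs4 : s ≤ 4 := by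
    have : Real.exp (n * (2 * R - mutInf P)) ≤ 1 :=
      Real.exp_le_one_iff.mpr (mul_nonpos_of_nonneg_of_nonpos hn'.le (by linarith))
    linarith
  have hu : (M : ℝ) ^ 2 * (E / N) ≤ p * s := by
    calc (M : ℝ) ^ 2 * (E / N) ≤ (M : ℝ) ^ 2 * (p * L) := by gcongr
      _ = p * s := by rw [hs]; ring
  have hu0 : 0 ≤ (M : ℝ) ^ 2 * (E / N) := by positivity
  constructor
  · have hv : s / p / 4 ≤ seqE T G M
        (fun c => (pairCount A c : ℝ)) := by
      refine le_trans ?_ hlow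
      calc s / p / 4 = (M : ℝ) ^ 2 * (L / p) / 4 := by rw [hs]; ring
        _ ≤ _ := by gcongr
    have h1 : (s / p / 4) ^ 2 ≤ π * (72 * p ^ 2 * s) := by
      calc (s / p / 4) ^ 2 ≤ _ := pow_le_pow_left₀ (by positivity) hv 2
        _ ≤ _ := hcs
        _ ≤ π * (8 * (p * s) + 16 * (p * s) ^ 2) := by
          refine mul_le_mul_of_nonneg_left (hsq.trans ?_) hπ0
          gcongr
        _ ≤ π * (72 * p ^ 2 * s) := by
          refine mul_le_mul_of_nonneg_left ?_ hπ0
          have e1 : p * s ≤ p ^ 2 * s := 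
            mul_le_mul_of_nonneg_right (le_self_pow₀ hp1 two_ne_zero) hs0.le
          have e2 : (p * s) ^ 2 ≤ p ^ 2 * s * 4 := by
            calc (p * s) ^ 2 = p ^ 2 * s * s := by ring
              _ ≤ _ := by gcongr
          linarith
    have h2 : s ≤ π * (1152 * p ^ 4) := by
      have e1 : (s / p / 4) ^ 2 * (16 * p ^ 2) = s * s := by field_simp; ring
      have e2 : s * s ≤ (π * (1152 * p ^ 4)) * s := by
        calc s * s = (s / p / 4) ^ 2 * (16 * p ^ 2) := e1.symm
          _ ≤ π * (72 * p ^ 2 * s) * (16 * p ^ 2) := by gcongr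
          _ = _ := by ring
      exact le_of_mul_le_mul_right e2 hs0
    rw [div_le_iff₀ (by positivity)]
    exact hsge.trans h2
  · calc π ≤ 4 * ((M : ℝ) ^ 2 * (E / N)) := hup
      _ ≤ 4 * (p * (4 * Real.exp (n * (2 * R - mutInf P)))) :=
        mul_le_mul_of_nonneg_left
          (hu.trans (mul_le_mul_of_nonneg_left hsle (by linarith))) (by norm_num)
      _ = _ := by ring

end Ensemble

lemma tendsto_log_affine_div (C k : ℝ) :
    Tendsto (fun x : ℝ => (C + k * Real.log (3 * (x + 1))) / x) atTop (nhds 0) := by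
  have h1 : Tendsto (fun x : ℝ => Real.log (3 * (x + 1)) / x) atTop (nhds 0) := by
    have h2 : Tendsto (fun x : ℝ => Real.log 6 / x + Real.log x / x) atTop (nhds 0) := by
      simpa using (tendsto_const_nhds.div_atTop tendsto_id).add
        Real.isLittleO_log_id_atTop.tendsto_div_nhds_zero
    refine tendsto_of_tendsto_of_tendsto_of_le_of_le' tendsto_const_nhds h2 ?_ ?_
    · filter_upwards [eventually_ge_atTop 1] with x hx
      exact div_nonneg (Real.log_nonneg (by linarith)) (by linarith)
    · filter_upwards [eventually_ge_atTop 1] with x hx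
      have hx0 : 0 < x := by linarith
      rw [← add_div, ← Real.log_mul (by norm_num) hx0.ne']
      exact div_le_div_of_nonneg_right (Real.log_le_log (by linarith) (by linarith)) hx0.le
  have h3 : Tendsto (fun x : ℝ => C / x + k * (Real.log (3 * (x + 1)) / x)) atTop (nhds 0) := by
    simpa using (tendsto_const_nhds.div_atTop tendsto_id).add (h1.const_mul k)
  refine h3.congr fun x => ?_
  ring

lemma tendsto_nseq {D : ℕ} (hD : 0 < D) :
    Tendsto (fun t => (nseq D t : ℝ)) atTop atTop := by
  refine tendsto_natCast_atTop_atTop.comp (tendsto_atTop_mono (fun t => ?_) tendsto_id)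
  show t ≤ D * (t + 1)
  nlinarith

lemma IsTypeDist.nseq {A : Type} {D : ℕ} {p : A → ℝ} (h : IsTypeDist D p) (t : ℕ) :
    IsTypeDist (nseq D t) p := fun a => by
  obtain ⟨k, hk⟩ := h a
  refine ⟨k * (t + 1), ?_⟩
  rw [RGV.nseq]
  push_cast
  rw [← hk]
  ring

end RGV

open RGV in
/-- For joint types with `I_P(X;X') ≥ 2R`, the probability that the type
enumerator is positive is exponentially `e^{n(2R − I_P(X;X'))}`. -/
theorem statement14 {α : Type} [Fintype α] [Nonempty α]
    (Q : α → ℝ) (D : ℕ) (hD : 0 < D) (hQ : IsDist Q) (hQD : IsTypeDist D Q)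
    (d : (α × α → ℝ) → ℝ) (hd : IsDistance d) (Δ : ℝ)
    (R δ : ℝ) (hR : 0 < R) (hδ : 0 < δ)
    (P : α × α → ℝ) (hP : Joint Q P) (hPD : IsTypeDist D P)
    (hPI : 2 * R ≤ mutInf P) (hPd : Δ < d P)
    (hrate : ∀ t : ℕ, RateCond (nseq D t) Q d Δ R δ) :
    Filter.Tendsto
      (fun t : ℕ => lrate (nseq D t)
        (prob (nseq D t) Q d Δ (Mof R (nseq D t))
          (fun c => 1 ≤ Nenum (nseq D t) P c)))
      Filter.atTop (nhds (((2 * R - mutInf P : ℝ)) : EReal)) := by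
  set k : ℕ := Fintype.card α + Fintype.card (α × α) with hk
  have hn : ∀ t, 0 < nseq D t := fun t => Nat.mul_pos hD t.succ_pos
  have hn' : ∀ t, (0 : ℝ) < nseq D t := fun t => by exact_mod_cast hn t
  set ℓ : ℕ → ℝ := fun t => Real.log (3 * ((nseq D t : ℝ) + 1)) with hℓ
  have hlim : ∀ C K : ℝ, Tendsto (fun t => (C + K * ℓ t) / nseq D t) atTop (nhds 0) :=
    fun C K => (tendsto_log_affine_div C K).comp (tendsto_nseq hD)
  set p : ℕ → ℝ := fun t => (3 * ((nseq D t : ℝ) + 1)) ^ k with hp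
  have hp0 : ∀ t, 0 < p t := fun t => pow_pos (by linarith [hn' t]) k
  have hlogp : ∀ t, Real.log (p t) = k * ℓ t := fun t => Real.log_pow _ _
  have hbounds : ∀ᶠ t in atTop,
      Real.exp (nseq D t * (2 * R - mutInf P)) / (1152 * p t ^ 4) ≤
        prob (nseq D t) Q d Δ (Mof R (nseq D t)) (fun c => 1 ≤ Nenum (nseq D t) P c) ∧
      prob (nseq D t) Q d Δ (Mof R (nseq D t)) (fun c => 1 ≤ Nenum (nseq D t) P c) ≤
        16 * p t * Real.exp (nseq D t * (2 * R - mutInf P)) := by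
    filter_upwards [(hlim (Real.log 24) k).eventually_le_const (by positivity : 0 < 2 * δ)]
      with t ht
    refine prob_Nenum_bounds (hn t) hQ (hQD.nseq t) hd hR hP (hPD.nseq t) hPI hPd (hrate t) rfl ?_
    rw [div_le_iff₀ (hn' t), ← hlogp, ← Real.log_mul (by norm_num) (hp0 t).ne',
      Real.log_le_iff_le_exp (mul_pos (by norm_num) (hp0 t))] at ht
    rw [Real.exp_neg, ← div_eq_mul_inv, div_le_one (Real.exp_pos _)]
    exact ht
  set π : ℕ → ℝ := fun t =>
    prob (nseq D t) Q d Δ (Mof R (nseq D t)) (fun c => 1 ≤ Nenum (nseq D t) P c)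
  have hlow0 : ∀ t, 0 < Real.exp (nseq D t * (2 * R - mutInf P)) / (1152 * p t ^ 4) := fun t =>
    div_pos (Real.exp_pos _) (mul_pos (by norm_num) (pow_pos (hp0 t) 4))
  have hreal : Tendsto (fun t => Real.log (π t) / nseq D t) atTop (nhds (2 * R - mutInf P)) := by
    have hlo := (tendsto_const_nhds (x := 2 * R - mutInf P)).sub (hlim (Real.log 1152) (4 * k))
    have hhi := (tendsto_const_nhds (x := 2 * R - mutInf P)).add (hlim (Real.log 16) k)
    rw [sub_zero] at hlo
    rw [add_zero] at hhi
    refine tendsto_of_tendsto_of_tendsto_of_le_of_le' hlo hhi ?_ ?_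
    · filter_upwards [hbounds] with t ht
      have h := Real.log_le_log (hlow0 t) ht.1
      rw [Real.log_div (Real.exp_ne_zero _) (mul_pos (by norm_num) (pow_pos (hp0 t) 4)).ne',
        Real.log_exp, Real.log_mul (by norm_num) (pow_pos (hp0 t) 4).ne', Real.log_pow,
        hlogp] at h
      rw [le_div_iff₀ (hn' t), sub_mul, div_mul_cancel₀ _ (hn' t).ne']
      push_cast at h
      linarith
    · filter_upwards [hbounds] with t ht
      have h := Real.log_le_log ((hlow0 t).trans_le ht.1) ht.2
      rw [Real.log_mul (mul_pos (by norm_num) (hp0 t)).ne' (Real.exp_ne_zero _), Real.log_exp,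
        Real.log_mul (by norm_num) (hp0 t).ne', hlogp] at h
      rw [div_le_iff₀ (hn' t), add_mul, div_mul_cancel₀ _ (hn' t).ne']
      linarith
  refine ((continuous_coe_real_ereal.tendsto _).comp hreal).congr' ?_
  filter_upwards [hbounds] with t ht
  exact (if_neg (not_le.mpr ((hlow0 t).trans_le ht.1))).symm
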